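/- Let G be an upper semicontinuous decomposition of ℝ² into compact convex sets. Then the quotient space ℝ²/G is homeomorphic to ℝ². -/

import Mathlib

section

open Set Filter Topology Metric

theorem exists_continuous_implicit {Z : Type*} [TopologicalSpace Z] (F : ℝ → Z → ℝ)
    (hF : Continuous fun p : ℝ × Z => F p.1 p.2) (hmono : ∀ z, StrictMono fun u => F u z)
    (hsurj : ∀ z, Function.Surjective fun u => F u z) :
    ∃ u : ℝ → Z → ℝ, (Continuous fun p : ℝ × Z => u p.1 p.2) ∧ ∀ v z, F (u v z) z = v := by
  choose u hu using fun v z => hsurj z v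
  refine ⟨u, ?_, hu⟩
  rw [continuous_iff_continuousAt]
  rintro ⟨v, z⟩
  have hFv : ∀ a, Continuous fun p : ℝ × Z => F a p.2 := fun a =>
    hF.comp (continuous_const.prodMk continuous_snd)
  refine tendsto_order.2 ⟨fun a ha => ?_, fun a ha => ?_⟩
  · have h1 : F a z < v := by
      have := hmono z ha
      simpa [hu] using this
    have : ∀ᶠ p : ℝ × Z in 𝓝 (v, z), F a p.2 < p.1 :=
      (isOpen_lt (hFv a) continuous_fst).mem_nhds h1
    filter_upwards [this] with p hp
    by_contra hcon
    have := (hmono p.2).monotone (not_lt.1 hcon)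
    simp only [hu] at this
    linarith
  · have h1 : v < F a z := by
      have := hmono z ha
      simpa [hu] using this
    have : ∀ᶠ p : ℝ × Z in 𝓝 (v, z), p.1 < F a p.2 :=
      (isOpen_lt continuous_fst (hFv a)).mem_nhds h1
    filter_upwards [this] with p hp
    by_contra hcon
    have := (hmono p.2).monotone (not_lt.1 hcon)
    simp only [hu] at this
    linarith

theorem exists_homeomorph_of_flow {E : Type*} [TopologicalSpace E] (c : ℝ → E → E)
    (hc : Continuous fun p : ℝ × E => c p.1 p.2) (hone : ∀ p, c 1 p = p)
    (hmul : ∀ a b p, c (a * b) p = c a (c b p)) (s : E → ℝ) (hs : Continuous s) {s₀ : ℝ}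
    (hs₀ : 0 < s₀) (hle : ∀ p, s₀ ≤ s p)
    (hanti : ∀ p, ∀ θ ∈ Icc (0 : ℝ) 1, s (c θ p) ≤ s p) :
    ∃ h : E ≃ₜ E, ∀ p, h p = c (s p) p := by
  have hpos : ∀ p, 0 < s p := fun p => hs₀.trans_le (hle p)
  let F : ℝ → E → ℝ := fun u z => u * s (c (max u 0) z)
  have hF : Continuous fun p : ℝ × E => F p.1 p.2 := by
    refine continuous_fst.mul (hs.comp (hc.comp (f := fun p : ℝ × E => (max p.1 0, p.2)) ?_))
    fun_prop
  have hmono : ∀ z, StrictMono fun u => F u z := by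
    intro z a b hab
    change a * s (c (max a 0) z) < b * s (c (max b 0) z)
    have key : s (c (max a 0) z) ≤ s (c (max b 0) z) := by
      rcases le_or_gt b 0 with hb | hb
      · rw [max_eq_right hb, max_eq_right (hab.le.trans hb)]
      · have : max a 0 = max a 0 / b * b := by field_simp
        rw [this, hmul, max_eq_left hb.le]
        refine hanti _ _ ⟨by positivity, (div_le_one hb).2 (max_le hab.le hb.le)⟩
    rcases le_or_gt a 0 with ha | ha
    · rcases le_or_gt b 0 with hb | hb
      · rw [max_eq_right hb, max_eq_right ha]
        exact mul_lt_mul_of_pos_right hab (hpos _)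
      · rcases ha.lt_or_eq with ha | ha
        · nlinarith [hpos (c (max a 0) z), hpos (c (max b 0) z)]
        · have := mul_pos hb (hpos (c (max b 0) z))
          rw [ha] at *
          linarith
    · calc a * s (c (max a 0) z) < b * s (c (max a 0) z) := mul_lt_mul_of_pos_right hab (hpos _)
        _ ≤ _ := mul_le_mul_of_nonneg_left key (ha.trans hab).le
  have hsurj : ∀ z, Function.Surjective fun u => F u z := by
    intro z
    refine Continuous.surjective (hF.comp (continuous_id.prodMk continuous_const)) ?_ ?_
    · refine tendsto_atTop_mono' _ ?_ (tendsto_id.atTop_mul_const hs₀)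
      filter_upwards [eventually_ge_atTop 0] with u hu
      exact mul_le_mul_of_nonneg_left (hle _) hu
    · refine tendsto_atBot_mono' _ ?_ (tendsto_id.atBot_mul_const hs₀)
      filter_upwards [eventually_le_atBot 0] with u hu
      exact mul_le_mul_of_nonpos_left (hle _) hu
  obtain ⟨u, hu, hFu⟩ := exists_continuous_implicit F hF hmono hsurj
  have hupos : ∀ z, 0 < u 1 z := by
    intro z
    by_contra hcon
    have := hFu 1 z
    have h2 : u 1 z * s (c (max (u 1 z) 0) z) ≤ 0 :=
      mul_nonpos_of_nonpos_of_nonneg (not_lt.1 hcon) (hpos _).le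
    change u 1 z * s (c (max (u 1 z) 0) z) = 1 at this
    linarith
  refine ⟨{ toFun := fun p => c (s p) p
            invFun := fun z => c (u 1 z) z
            left_inv := ?_
            right_inv := ?_
            continuous_toFun := hc.comp (hs.prodMk continuous_id)
            continuous_invFun := hc.comp ((hu.comp (continuous_const.prodMk
              continuous_id)).prodMk continuous_id) }, fun p => rfl⟩
  · intro p
    change c (u 1 (c (s p) p)) (c (s p) p) = p
    have h1 : F (s p)⁻¹ (c (s p) p) = 1 := by
      change (s p)⁻¹ * s (c (max (s p)⁻¹ 0) (c (s p) p)) = 1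
      rw [max_eq_left (inv_pos.2 (hpos p)).le, ← hmul, inv_mul_cancel₀ (hpos p).ne', hone,
        inv_mul_cancel₀ (hpos p).ne']
    have h2 : u 1 (c (s p) p) = (s p)⁻¹ :=
      (hmono (c (s p) p)).injective (by simp only [h1, hFu])
    rw [h2, ← hmul, inv_mul_cancel₀ (hpos p).ne', hone]
  · intro z
    change c (s (c (u 1 z) z)) (c (u 1 z) z) = z
    have h1 := hFu 1 z
    change u 1 z * s (c (max (u 1 z) 0) z) = 1 at h1
    rw [max_eq_left (hupos z).le, mul_comm] at h1
    rw [← hmul, h1, hone]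

theorem exists_ramp (δ : ℕ → ℝ) (hδ : ∀ i, 0 < δ i) (hhalf : ∀ i, δ (i + 1) ≤ δ i / 2) (m : ℕ)
    (hm : 0 < m) :
    ∃ φ : ℝ → ℝ, Continuous φ ∧ (∀ x, 0 ≤ φ x ∧ φ x ≤ 1) ∧ (∀ x, δ 0 ≤ x → φ x = 1) ∧
      (∀ x, x ≤ δ m → φ x = 0) ∧
      (∀ x y, (∀ i ≤ m + 2, x < δ (i + 1) → y < δ i) → φ y ≤ φ x + 2 / m) ∧
      ∃ d > 0, ∀ x y, |x - y| < d → |φ x - φ y| ≤ 1 / m := by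
  have hanti : Antitone δ := antitone_nat_of_succ_le fun i => by linarith [hhalf i, hδ i]
  have hm' : (0 : ℝ) < m := by exact_mod_cast hm
  let χ : ℕ → ℝ → ℝ := fun i x => max 0 (min 1 ((x - δ (i + 1)) / (δ i - δ (i + 1))))
  have hgap : ∀ i, δ (i + 1) ≤ δ i - δ (i + 1) := fun i => by linarith [hhalf i]
  have hgap' : ∀ i, 0 < δ i - δ (i + 1) := fun i => (hδ _).trans_le (hgap i)
  have χ0 : ∀ i x, 0 ≤ χ i x := fun i x => le_max_left _ _
  have χ1 : ∀ i x, χ i x ≤ 1 := fun i x => max_le zero_le_one (min_le_left _ _)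
  have χone : ∀ i x, δ i ≤ x → χ i x = 1 := by
    intro i x hx
    have : 1 ≤ (x - δ (i + 1)) / (δ i - δ (i + 1)) := (one_le_div (hgap' i)).2 (by linarith)
    simp [χ, this]
  have χzero : ∀ i x, x ≤ δ (i + 1) → χ i x = 0 := by
    intro i x hx
    have : (x - δ (i + 1)) / (δ i - δ (i + 1)) ≤ 0 :=
      div_nonpos_of_nonpos_of_nonneg (by linarith) (hgap' i).le
    exact max_eq_left ((min_le_right _ _).trans this)
  have χc : ∀ i, Continuous (χ i) := fun i => by fun_prop
  refine ⟨fun x => (∑ i ∈ Finset.range m, χ i x) / m, ?_, ?_, ?_, ?_, ?_, ?_⟩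
  · exact (continuous_finsetSum _ fun i _ => χc i).div_const _
  · intro x
    refine ⟨div_nonneg (Finset.sum_nonneg fun i _ => χ0 i x) hm'.le, (div_le_one hm').2 ?_⟩
    calc _ ≤ ∑ i ∈ Finset.range m, (1 : ℝ) := Finset.sum_le_sum fun i _ => χ1 i x
      _ = m := by simp
  · intro x hx
    rw [div_eq_one_iff_eq hm'.ne']
    rw [Finset.sum_congr rfl fun i _ => χone i x ((hanti (Nat.zero_le i)).trans hx)]
    simp
  · intro x hx
    dsimp only
    rw [Finset.sum_eq_zero fun i hi => χzero i x (hx.trans (hanti (Finset.mem_range.1 hi))),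
      zero_div]
  · intro x y hxy
    have key : ∀ i < m, χ i y ≤ χ (i + 2) x := by
      intro i hi
      rcases le_or_gt (δ (i + 2)) x with h | h
      · rw [χone _ _ h]
        exact χ1 _ _
      · rw [χzero i y (hxy (i + 1) (by omega) h).le]
        exact χ0 _ _
    have h1 : ∑ i ∈ Finset.range m, χ i y ≤ ∑ i ∈ Finset.range m, χ i x + 2 := by
      calc _ ≤ ∑ i ∈ Finset.range m, χ (i + 2) x :=
            Finset.sum_le_sum fun i hi => key i (Finset.mem_range.1 hi)
        _ ≤ ∑ i ∈ Finset.range (m + 2), χ i x := by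
            rw [Finset.sum_range_succ', Finset.sum_range_succ']
            have := χ0 0 x
            have := χ0 (0 + 1) x
            linarith
        _ ≤ _ := by
            rw [Finset.sum_range_succ, Finset.sum_range_succ]
            linarith [χ1 m x, χ1 (m + 1) x]
    rw [← add_div]
    exact div_le_div_of_nonneg_right h1 hm'.le
  · have χL : ∀ i < m, ∀ x y, |χ i x - χ i y| ≤ |x - y| / δ m := by
      intro i hi x y
      calc |χ i x - χ i y| ≤ |min 1 ((x - δ (i + 1)) / (δ i - δ (i + 1))) -
            min 1 ((y - δ (i + 1)) / (δ i - δ (i + 1)))| := by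
              simpa [χ, max_comm] using abs_max_sub_max_le_abs
                (min 1 ((x - δ (i + 1)) / (δ i - δ (i + 1))))
                (min 1 ((y - δ (i + 1)) / (δ i - δ (i + 1)))) 0
        _ ≤ |(x - δ (i + 1)) / (δ i - δ (i + 1)) - (y - δ (i + 1)) / (δ i - δ (i + 1))| := by
              simpa using abs_min_sub_min_le_max 1 ((x - δ (i + 1)) / (δ i - δ (i + 1)))
                1 ((y - δ (i + 1)) / (δ i - δ (i + 1)))
        _ = |x - y| / (δ i - δ (i + 1)) := by
              rw [← sub_div, abs_div, abs_of_pos (hgap' i)]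
              ring_nf
        _ ≤ _ := by
              refine div_le_div_of_nonneg_left (abs_nonneg _) (hδ m) ?_
              exact (hanti hi).trans (hgap i)
    refine ⟨δ m / m, div_pos (hδ m) hm', fun x y hxy => ?_⟩
    dsimp only
    rw [← sub_div, ← Finset.sum_sub_distrib, abs_div, abs_of_pos hm']
    refine div_le_div_of_nonneg_right ?_ hm'.le
    calc _ ≤ ∑ i ∈ Finset.range m, |χ i x - χ i y| := Finset.abs_sum_le_sum_abs _ _
      _ ≤ ∑ i ∈ Finset.range m, |x - y| / δ m :=
          Finset.sum_le_sum fun i hi => χL i (Finset.mem_range.1 hi) x y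
      _ = m * (|x - y| / δ m) := by simp
      _ ≤ m * ((δ m / m) / δ m) := by
          refine mul_le_mul_of_nonneg_left ?_ hm'.le
          exact div_le_div_of_nonneg_right hxy.le (hδ m).le
      _ = 1 := by
          have := (hδ m).ne'
          field_simp

theorem exists_shell_homeomorph {E M : Type*} [TopologicalSpace E] [PseudoMetricSpace M]
    (P : E → M) (hP : Continuous P) (A : Set E) (c : ℕ → ℝ → E → E)
    (hc : ∀ n, Continuous fun p : ℝ × E => c n p.1 p.2) (hone : ∀ n p, c n 1 p = p)
    (hmul : ∀ n a b p, c n (a * b) p = c n a (c n b p))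
    (hfam : ∀ δ > 0, ∃ δ' > 0, ∀ᶠ n in atTop, ∀ p, infDist (P p) (P '' A) < δ' →
      ∀ θ ∈ Icc (0 : ℝ) 1, dist (P (c n θ p)) (P p) < δ)
    {δ η s₀ : ℝ} (hδ : 0 < δ) (hη : 0 < η) (hs₀ : 0 < s₀) (hs₀' : s₀ < 1) :
    ∃ (n : ℕ) (h : E ≃ₜ E) (s : E → ℝ), (∀ p, h p = c n (s p) p) ∧
      (∀ p, s₀ ≤ s p ∧ s p ≤ 1) ∧ (∀ p, dist (P (h p)) (P p) < δ) ∧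
      (∀ p, s p ≠ 1 → infDist (P p) (P '' A) < δ) ∧
      ∃ δ' > 0, (∀ p, infDist (P p) (P '' A) < δ' → s p = s₀) ∧
        ∀ p q, dist (P p) (P q) < δ' → |s p - s q| ≤ η := by
  choose! g hg0 hg using hfam
  let δs : ℕ → ℝ := fun i => Nat.rec (min δ (g δ)) (fun _ x => min (x / 2) (g (x / 2))) i
  have hδs0 : δs 0 = min δ (g δ) := rfl
  have hδss : ∀ i, δs (i + 1) = min (δs i / 2) (g (δs i / 2)) := fun i => rfl
  have hpos : ∀ i, 0 < δs i := by
    intro i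
    induction i with
    | zero => exact lt_min hδ (hg0 _ hδ)
    | succ i ih => exact lt_min (half_pos ih) (hg0 _ (half_pos ih))
  have hhalf : ∀ i, δs (i + 1) ≤ δs i / 2 := fun i => min_le_left _ _
  obtain ⟨m, hm⟩ := exists_nat_gt (3 / η)
  have hm0 : 0 < m := by
    have : (0 : ℝ) < m := lt_trans (by positivity) hm
    exact_mod_cast this
  have hm0' : (0 : ℝ) < m := by exact_mod_cast hm0
  have hmη : 3 / (m : ℝ) ≤ η := by
    rw [div_le_iff₀ hm0']
    rw [div_lt_iff₀ hη] at hm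
    linarith
  obtain ⟨φ, hφc, hφ01, hφone, hφzero, hφle, d, hd, hφd⟩ := exists_ramp δs hpos hhalf m hm0
  set D : E → ℝ := fun p => infDist (P p) (P '' A) with hD
  have hDc : Continuous D := (continuous_infDist_pt _).comp hP
  have hDdist : ∀ p q, |D p - D q| ≤ dist (P p) (P q) := by
    intro p q
    have := (lipschitz_infDist_pt (P '' A)).dist_le_mul (P p) (P q)
    simpa [Real.dist_eq] using this
  have hev : ∀ᶠ n in atTop, (∀ i ∈ Finset.range (m + 3), ∀ p, D p < g (δs i / 2) →
      ∀ θ ∈ Icc (0 : ℝ) 1, dist (P (c n θ p)) (P p) < δs i / 2) ∧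
      ∀ p, D p < g δ → ∀ θ ∈ Icc (0 : ℝ) 1, dist (P (c n θ p)) (P p) < δ := by
    refine Filter.Eventually.and ?_ (hg _ hδ)
    rw [Finset.eventually_all]
    exact fun i _ => hg _ (half_pos (hpos i))
  obtain ⟨n, hn, hnδ⟩ := hev.exists
  have hstep : ∀ p, ∀ θ ∈ Icc (0 : ℝ) 1, ∀ i ≤ m + 2, D p < δs (i + 1) → D (c n θ p) < δs i := by
    intro p θ hθ i hi hp
    have h1 := hn i (Finset.mem_range.2 (by omega)) p (hp.trans_le (min_le_right _ _)) θ hθ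
    have h2 := abs_le.1 (hDdist (c n θ p) p)
    have h3 := hhalf i
    linarith [h2.2]
  let s₁ : E → ℝ := fun p => s₀ + (1 - s₀) * φ (D p)
  have hs₁c : Continuous s₁ := by fun_prop
  have hs₁0 : ∀ p, s₀ ≤ s₁ p := fun p => by
    have := mul_nonneg (sub_nonneg.2 hs₀'.le) (hφ01 (D p)).1
    simp only [s₁]
    linarith
  have hs₁1 : ∀ p, s₁ p ≤ 1 := fun p => by
    have := mul_le_mul_of_nonneg_left (hφ01 (D p)).2 (sub_nonneg.2 hs₀'.le)
    simp only [s₁]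
    linarith
  let s : E → ℝ := fun p => sSup ((fun θ => s₁ (c n θ p)) '' Icc (0 : ℝ) 1)
  have hsc : Continuous s := by
    refine isCompact_Icc.continuous_sSup (f := fun p θ => s₁ (c n θ p)) ?_
    exact hs₁c.comp ((hc n).comp continuous_swap)
  have hbdd : ∀ p, BddAbove ((fun θ => s₁ (c n θ p)) '' Icc (0 : ℝ) 1) := fun p =>
    ⟨1, by rintro _ ⟨θ, -, rfl⟩; exact hs₁1 _⟩
  have hsle : ∀ p b, (∀ θ ∈ Icc (0 : ℝ) 1, s₁ (c n θ p) ≤ b) → s p ≤ b := by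
    intro p b hb
    refine csSup_le ⟨_, 1, by simp, rfl⟩ ?_
    rintro _ ⟨θ, hθ, rfl⟩
    exact hb θ hθ
  have hles : ∀ p, ∀ θ ∈ Icc (0 : ℝ) 1, s₁ (c n θ p) ≤ s p := fun p θ hθ =>
    le_csSup (hbdd p) ⟨θ, hθ, rfl⟩
  have hs₁s : ∀ p, s₁ p ≤ s p := fun p => by simpa [hone] using hles p 1 (by simp)
  have hss₁ : ∀ p, s p ≤ s₁ p + 2 / m := by
    intro p
    refine hsle p _ fun θ hθ => ?_
    have h1 := hφle (D p) (D (c n θ p)) (hstep p θ hθ)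
    have h2 := mul_le_mul_of_nonneg_left h1 (sub_nonneg.2 hs₀'.le)
    have h3 : (1 - s₀) * (2 / m) ≤ 2 / m := by
      have : (0 : ℝ) ≤ 2 / m := by positivity
      nlinarith
    simp only [s₁]
    linarith
  have hs1 : ∀ p, s p ≤ 1 := fun p => hsle p 1 fun θ _ => hs₁1 _
  have hsD : ∀ p, s p ≠ 1 → D p < δs 0 := by
    intro p hp
    by_contra hcon
    refine hp (le_antisymm (hs1 p) ?_)
    have : s₁ p = 1 := by
      simp only [s₁, hφone _ (not_lt.1 hcon)]
      ring
    exact this.ge.trans (hs₁s p)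
  obtain ⟨h, hh⟩ := exists_homeomorph_of_flow (c n) (hc n) (hone n) (hmul n) s hsc hs₀
    (fun p => (hs₁0 p).trans (hs₁s p)) (by
      intro p θ hθ
      refine hsle _ _ fun θ' hθ' => ?_
      rw [← hmul]
      exact hles _ _ ⟨mul_nonneg hθ'.1 hθ.1, mul_le_one₀ hθ'.2 hθ.1 hθ.2⟩)
  refine ⟨n, h, s, hh, fun p => ⟨(hs₁0 p).trans (hs₁s p), hs1 p⟩, ?_, ?_, min (δs (m + 1)) d,
    lt_min (hpos (m + 1)) hd, ?_, ?_⟩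
  · intro p
    by_cases hp : s p = 1
    · rw [hh, hp, hone, dist_self]
      exact hδ
    · rw [hh]
      exact hnδ p ((hsD p hp).trans_le (min_le_right _ _)) _
        ⟨hs₀.le.trans ((hs₁0 p).trans (hs₁s p)), hs1 p⟩
  · exact fun p hp => (hsD p hp).trans_le (min_le_left _ _)
  · intro p hp
    refine le_antisymm (hsle p _ fun θ hθ => ?_) ((hs₁0 p).trans (hs₁s p))
    have := hstep p θ hθ m (by omega) (hp.trans_le (min_le_left _ _))
    simp only [s₁, hφzero _ this.le]
    linarith
  · intro p q hpq
    have h1 := abs_le.1 (hφd (D p) (D q)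
      ((hDdist p q).trans_lt (hpq.trans_le (min_le_right _ _))))
    have h2 : |s₁ p - s₁ q| ≤ 1 / m := by
      have : s₁ p - s₁ q = (1 - s₀) * (φ (D p) - φ (D q)) := by simp only [s₁]; ring
      rw [this, abs_mul, abs_of_pos (sub_pos.2 hs₀')]
      refine (mul_le_of_le_one_left (abs_nonneg _) (by linarith)).trans (abs_le.2 h1)
    have h3 := abs_le.1 h2
    have h4 : (3 : ℝ) / m = 1 / m + 2 / m := by ring
    refine (abs_le.2 ⟨?_, ?_⟩).trans hmη
    · linarith [hs₁s p, hss₁ q, h3.1]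
    · linarith [hs₁s q, hss₁ p, h3.2]

/-- A continuous map from the plane whose fibres are convex and such that points with image close
to the image of a bounded set form a bounded set. -/
structure IsConvexDecomposition {M : Type*} [MetricSpace M] (P : ℝ × ℝ → M) : Prop where
  continuous : Continuous P
  convex : ∀ p, Convex ℝ {q | P q = P p}
  bounded : ∀ C, Bornology.IsBounded C →
    ∃ δ > 0, Bornology.IsBounded {q | ∃ p ∈ C, dist (P q) (P p) < δ}

/-- There are homeomorphisms of the plane, moving points by little as seen through `P` and
supported near `A`, that make every point-inverse meeting `A` smaller than `e` as measured by `μ`,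
while increasing the `μ`-size of the others by at most `e`. -/
def Shrinks {E M : Type*} [TopologicalSpace E] [MetricSpace M] (P : E → M) (μ : E → E → ℝ)
    (e : ℝ) (A : Set E) : Prop :=
  ∀ δ > 0, ∃ h : E ≃ₜ E, (∀ p, dist (P (h p)) (P p) < δ) ∧
    (∀ p, h p ≠ p → ∃ k ∈ A, dist (P p) (P k) < δ) ∧
    ∃ δ' > 0, (∀ p q, dist (P p) (P q) < δ' → μ (h p) (h q) ≤ μ p q + e) ∧
      ∀ k ∈ A, ∀ p q, dist (P p) (P k) < δ' → dist (P q) (P k) < δ' → μ (h p) (h q) ≤ e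

section Shrinks

variable {E M : Type*} [TopologicalSpace E] [MetricSpace M] {P : E → M} {μ : E → E → ℝ}
  {e e' : ℝ} {A B : Set E}

theorem Shrinks.empty (he : 0 ≤ e) : Shrinks P μ e ∅ := fun δ hδ =>
  ⟨Homeomorph.refl E, fun p => by simpa using hδ, fun p hp => (hp rfl).elim, 1, one_pos,
    fun p q _ => by simpa using he, fun k hk => hk.elim⟩

theorem Shrinks.union (he : 0 ≤ e) (he' : 0 ≤ e') (hA : Shrinks P μ e A)
    (hB : Shrinks P μ e' B) : Shrinks P μ (e + e') (A ∪ B) := by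
  intro δ hδ
  obtain ⟨h, h1, h2, d, hd, h3, h4⟩ := hA (δ / 2) (half_pos hδ)
  obtain ⟨f, f1, f2, d', hd', f3, f4⟩ := hB (min (δ / 2) (d / 4)) (by positivity)
  have f1' : ∀ p, dist (P (f p)) (P p) < d / 4 := fun p => (f1 p).trans_le (min_le_right _ _)
  refine ⟨f.trans h, ?_, ?_, min d' (d / 4), by positivity, ?_, ?_⟩
  · intro p
    have := dist_triangle (P (h (f p))) (P (f p)) (P p)
    have := h1 (f p)
    have := (f1 p).trans_le (min_le_left _ _)
    simp only [Homeomorph.trans_apply]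
    linarith
  · intro p hp
    by_cases hfp : f p = p
    · rw [Homeomorph.trans_apply, hfp] at hp
      obtain ⟨k, hk, hpk⟩ := h2 p hp
      exact ⟨k, Or.inl hk, by linarith⟩
    · obtain ⟨k, hk, hpk⟩ := f2 p hfp
      exact ⟨k, Or.inr hk, by linarith [min_le_left (δ / 2) (d / 4)]⟩
  · intro p q hpq
    have a1 := f3 p q (hpq.trans_le (min_le_left _ _))
    have a2 := h3 (f p) (f q) (by
      have := dist_triangle4 (P (f p)) (P p) (P q) (P (f q))
      have := f1' p
      have := f1' q
      rw [dist_comm] at this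
      linarith [hpq.trans_le (min_le_right _ _)])
    simp only [Homeomorph.trans_apply]
    linarith
  · rintro k (hk | hk) p q hp hq
    · have a2 := h4 k hk (f p) (f q) ?_ ?_
      · simp only [Homeomorph.trans_apply]
        linarith
      · have := dist_triangle (P (f p)) (P p) (P k)
        linarith [f1' p, hp.trans_le (min_le_right _ _)]
      · have := dist_triangle (P (f q)) (P q) (P k)
        linarith [f1' q, hq.trans_le (min_le_right _ _)]
    · have a1 := f4 k hk p q (hp.trans_le (min_le_left _ _)) (hq.trans_le (min_le_left _ _))
      have a2 := h3 (f p) (f q) (by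
        have := dist_triangle4 (P (f p)) (P p) (P q) (P (f q))
        have := dist_triangle_right (P p) (P q) (P k)
        have := f1' p
        have := f1' q
        rw [dist_comm] at this
        linarith [hp.trans_le (min_le_right _ _), hq.trans_le (min_le_right _ _)])
      simp only [Homeomorph.trans_apply]
      linarith

theorem Shrinks.biUnion {ι : Type*} (s : Finset ι) (K : ι → Set E)
    (hK : ∀ i ∈ s, ∀ e > 0, Shrinks P μ e (K i)) : ∀ e > 0, Shrinks P μ e (⋃ i ∈ s, K i) := by
  classical
  induction s using Finset.induction_on with
  | empty => exact fun e he => by simpa using Shrinks.empty he.le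
  | insert a s ha ih =>
    intro e he
    rw [Finset.set_biUnion_insert, ← add_halves e]
    exact (hK a (by simp) _ (half_pos he)).union (half_pos he).le (half_pos he).le
      (ih (fun i hi => hK i (by simp [hi])) _ (half_pos he))

theorem Shrinks.of_family {V : Type*} [NormedAddCommGroup V] [NormedSpace ℝ V]
    (hP : Continuous P) (c : ℕ → ℝ → E → E)
    (hc : ∀ n, Continuous fun p : ℝ × E => c n p.1 p.2) (hone : ∀ n p, c n 1 p = p)
    (hmul : ∀ n a b p, c n (a * b) p = c n a (c n b p))
    (hfam : ∀ δ > 0, ∃ δ' > 0, ∀ᶠ n in atTop, ∀ p, ∀ k ∈ A, dist (P p) (P k) < δ' →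
      ∀ θ ∈ Icc (0 : ℝ) 1, dist (P (c n θ p)) (P p) < δ)
    (pr : E → V) (o : V) (hpr : ∀ n θ p, pr (c n θ p) = o + θ • (pr p - o)) {δb B : ℝ}
    (hδb : 0 < δb) (hB : ∀ p, ∀ k ∈ A, dist (P p) (P k) < δb → ‖pr p - o‖ ≤ B) :
    ∀ e > 0, Shrinks P (fun p q => ‖pr p - pr q‖) e A := by
  intro e he
  rcases A.eq_empty_or_nonempty with rfl | hA
  · exact Shrinks.empty he.le
  intro δ hδ
  have hinf : ∀ p d, infDist (P p) (P '' A) < d ↔ ∃ k ∈ A, dist (P p) (P k) < d := by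
    intro p d
    rw [infDist_lt_iff (hA.image P)]
    simp
  have hB0 : 0 ≤ B := by
    obtain ⟨k, hk⟩ := hA
    exact (norm_nonneg _).trans (hB k k hk (by simpa using hδb))
  have hs₀ : 0 < min (1 / 2) (e / (2 * (B + 1))) := by positivity
  have hs₀e : min (1 / 2) (e / (2 * (B + 1))) * (2 * (B + 1)) ≤ e := by
    rw [← le_div_iff₀ (by positivity)]
    exact min_le_right _ _
  obtain ⟨n, h, s, hh, hs, hhd, hsD, d, hd, hd1, hd2⟩ := exists_shell_homeomorph P hP A c hc hone
    hmul (fun δ hδ => by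
      obtain ⟨δ', hδ', hev⟩ := hfam δ hδ
      refine ⟨δ', hδ', hev.mono fun n hn p hp => ?_⟩
      obtain ⟨k, hk, hpk⟩ := (hinf _ _).1 hp
      exact hn p k hk hpk) (δ := min δ δb) (η := e / (B + 1)) (lt_min hδ hδb) (by positivity) hs₀
      ((min_le_left _ _).trans_lt (by norm_num))
  have hne : ∀ p, s p ≠ 1 → ∃ k ∈ A, dist (P p) (P k) < min δ δb := fun p hp =>
    (hinf _ _).1 (hsD p hp)
  refine ⟨h, fun p => (hhd p).trans_le (min_le_left _ _), ?_, min d δb, lt_min hd hδb, ?_, ?_⟩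
  · intro p hp
    have : s p ≠ 1 := fun hsp => hp (by rw [hh, hsp, hone])
    obtain ⟨k, hk, hpk⟩ := hne p this
    exact ⟨k, hk, hpk.trans_le (min_le_left _ _)⟩
  · have main : ∀ p q, s q ≠ 1 → dist (P p) (P q) < min d δb →
        ‖pr (h p) - pr (h q)‖ ≤ ‖pr p - pr q‖ + e := by
      intro p q hq hpq
      obtain ⟨k, hk, hqk⟩ := hne q hq
      have h1 := hB q k hk (hqk.trans_le (min_le_right _ _))
      have h2 : pr (h p) - pr (h q) = s p • (pr p - pr q) + (s p - s q) • (pr q - o) := by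
        rw [hh, hh, hpr, hpr]
        module
      rw [h2]
      refine (norm_add_le _ _).trans (add_le_add ?_ ?_)
      · rw [norm_smul, Real.norm_of_nonneg (hs₀.le.trans (hs p).1)]
        exact mul_le_of_le_one_left (norm_nonneg _) (hs p).2
      · rw [norm_smul, Real.norm_eq_abs]
        calc |s p - s q| * ‖pr q - o‖ ≤ e / (B + 1) * (B + 1) :=
              mul_le_mul (hd2 p q (hpq.trans_le (min_le_left _ _))) (by linarith)
                (norm_nonneg _) (by positivity)
          _ = e := by field_simp
    intro p q hpq
    by_cases hq : s q = 1
    · by_cases hp : s p = 1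
      · dsimp only
        rw [hh, hh, hp, hq, hone, hone]
        linarith
      · have := main q p hp (by rwa [dist_comm])
        dsimp only
        rwa [norm_sub_rev (pr (h p)), norm_sub_rev (pr p)]
    · exact main p q hq hpq
  · intro k hk p q hp hq
    have h1 := hd1 p ((hinf _ _).2 ⟨k, hk, hp.trans_le (min_le_left _ _)⟩)
    have h2 := hd1 q ((hinf _ _).2 ⟨k, hk, hq.trans_le (min_le_left _ _)⟩)
    have h3 := hB p k hk (hp.trans_le (min_le_right _ _))
    have h4 := hB q k hk (hq.trans_le (min_le_right _ _))
    have h5 : pr (h p) - pr (h q) =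
        min (1 / 2) (e / (2 * (B + 1))) • ((pr p - o) - (pr q - o)) := by
      rw [hh, hh, hpr, hpr, h1, h2]
      module
    dsimp only
    rw [h5, norm_smul, Real.norm_of_nonneg hs₀.le]
    refine (mul_le_mul_of_nonneg_left ?_ hs₀.le).trans hs₀e
    exact (norm_sub_le _ _).trans (by linarith)

end Shrinks

namespace IsConvexDecomposition

variable {M : Type*} [MetricSpace M] {P : ℝ × ℝ → M}

theorem exists_isCompact (hP : IsConvexDecomposition P) {A : Set (ℝ × ℝ)} (hA : IsCompact A) :
    ∃ K : Set (ℝ × ℝ), IsCompact K ∧ ∃ δ > 0, ∀ p, ∀ k ∈ A, dist (P p) (P k) < δ → p ∈ K := by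
  obtain ⟨δ, hδ, hb⟩ := hP.bounded A hA.isBounded
  exact ⟨closure {q | ∃ p ∈ A, dist (P q) (P p) < δ}, hb.isCompact_closure, δ, hδ,
    fun p k hk hpk => subset_closure ⟨k, hk, hpk⟩⟩

theorem isCompact_saturation (hP : IsConvexDecomposition P) {A : Set (ℝ × ℝ)} (hA : IsCompact A) :
    IsCompact (P ⁻¹' (P '' A)) := by
  obtain ⟨K, hK, δ, hδ, hKδ⟩ := hP.exists_isCompact hA
  refine hK.of_isClosed_subset ((hA.image hP.continuous).isClosed.preimage hP.continuous) ?_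
  rintro p ⟨k, hk, hkp⟩
  exact hKδ p k hk (by simpa [hkp] using hδ)

theorem isCompact_fiber (hP : IsConvexDecomposition P) (p : ℝ × ℝ) :
    IsCompact {q | P q = P p} := by
  have := hP.isCompact_saturation (isCompact_singleton (x := p))
  simpa [preimage, eq_comm] using this

theorem robust (hP : IsConvexDecomposition P) {A : Set (ℝ × ℝ)} (hA : IsCompact A)
    (F : (ℝ × ℝ) → (ℝ × ℝ) → ℝ) (hF : Continuous fun x : (ℝ × ℝ) × (ℝ × ℝ) => F x.1 x.2) (v : ℝ)
    (h : ∀ k ∈ A, ∀ p q, P p = P k → P q = P k → F p q < v) :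
    ∃ δ > 0, ∀ k ∈ A, ∀ p q, dist (P p) (P k) < δ → dist (P q) (P k) < δ → F p q < v := by
  obtain ⟨K, hK, δ, hδ, hKδ⟩ := hP.exists_isCompact hA
  let T : Set ((ℝ × ℝ) × (ℝ × ℝ) × (ℝ × ℝ)) :=
    (A ×ˢ (K ×ˢ K)) ∩ {x | v ≤ F x.2.1 x.2.2}
  have hT : IsCompact T := (hA.prod (hK.prod hK)).inter_right
    (isClosed_le continuous_const (hF.comp continuous_snd))
  let g : (ℝ × ℝ) × (ℝ × ℝ) × (ℝ × ℝ) → ℝ := fun x =>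
    max (dist (P x.2.1) (P x.1)) (dist (P x.2.2) (P x.1))
  have hPc := hP.continuous
  have hg : Continuous g := by fun_prop
  have : ∃ d > 0, ∀ x ∈ T, d ≤ g x := by
    rcases T.eq_empty_or_nonempty with hT0 | hT0
    · exact ⟨1, one_pos, by simp [hT0]⟩
    · obtain ⟨x, hx, hmin⟩ := hT.exists_isMinOn hT0 hg.continuousOn
      refine ⟨g x, ?_, fun y hy => hmin hy⟩
      by_contra hcon
      obtain ⟨h1, h2⟩ := max_le_iff.1 (not_lt.1 hcon)
      exact absurd (h x.1 hx.1.1 x.2.1 x.2.2 (dist_le_zero.1 h1) (dist_le_zero.1 h2))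
        (not_lt.2 hx.2)
  obtain ⟨d, hd, hdT⟩ := this
  refine ⟨min d δ, lt_min hd hδ, fun k hk p q hp hq => ?_⟩
  by_contra hcon
  have := hdT (k, p, q) ⟨⟨hk, hKδ p k hk (hp.trans_le (min_le_right _ _)),
    hKδ q k hk (hq.trans_le (min_le_right _ _))⟩, not_lt.1 hcon⟩
  have h2 : g (k, p, q) < d := max_lt (hp.trans_le (min_le_left _ _))
    (hq.trans_le (min_le_left _ _))
  linarith

end IsConvexDecomposition

theorem Convex.three_mem {V : Type*} [AddCommGroup V] [Module ℝ V] {s : Set V} (hs : Convex ℝ s)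
    {u v w : V} (hu : u ∈ s) (hv : v ∈ s) (hw : w ∈ s) {a b c : ℝ} (ha : 0 ≤ a) (hb : 0 ≤ b)
    (hc : 0 ≤ c) (habc : a + b + c = 1) : a • u + b • v + c • w ∈ s := by
  have := hs.sum_mem (t := Finset.univ) (w := ![a, b, c]) (z := ![u, v, w])
    (by intro i _; fin_cases i <;> simpa) (by simpa [Fin.sum_univ_three] using habc)
    (by intro i _; fin_cases i <;> simpa)
  simpa [Fin.sum_univ_three] using this

/-- Twice the signed area of a triangle. -/
def signedArea (u v w : ℝ × ℝ) : ℝ := (v.1 - u.1) * (w.2 - u.2) - (v.2 - u.2) * (w.1 - u.1)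

theorem exists_common_point {u v w : ℝ × ℝ} (h : signedArea u v w ≠ 0) :
    ∃ g : ℝ × ℝ, ∀ᶠ x : (ℝ × ℝ) × (ℝ × ℝ) × (ℝ × ℝ) in 𝓝 (u, v, w), ∀ s : Set (ℝ × ℝ),
      Convex ℝ s → x.1 ∈ s → x.2.1 ∈ s → x.2.2 ∈ s → g ∈ s := by
  let g : ℝ × ℝ := ((u.1 + v.1 + w.1) / 3, (u.2 + v.2 + w.2) / 3)
  refine ⟨g, ?_⟩
  let D : (ℝ × ℝ) × (ℝ × ℝ) × (ℝ × ℝ) → ℝ := fun x => signedArea x.1 x.2.1 x.2.2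
  have hD : Continuous D := by unfold D signedArea; fun_prop
  have aux : ∀ N : (ℝ × ℝ) × (ℝ × ℝ) × (ℝ × ℝ) → ℝ, Continuous N →
      N (u, v, w) = signedArea u v w / 3 → ∀ᶠ x in 𝓝 (u, v, w), 0 < N x / D x := by
    intro N hN hval
    have hc : ContinuousAt (fun x => N x / D x) (u, v, w) :=
      hN.continuousAt.div hD.continuousAt h
    refine hc.eventually_mem (isOpen_Ioi.mem_nhds ?_)
    change 0 < N (u, v, w) / signedArea u v w
    rw [hval, div_right_comm, div_self h]
    norm_num
  have h1 := aux (fun x => signedArea g x.2.1 x.2.2) (by unfold signedArea; fun_prop)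
    (by simp only [signedArea, g]; ring)
  have h2 := aux (fun x => signedArea x.1 g x.2.2) (by unfold signedArea; fun_prop)
    (by simp only [signedArea, g]; ring)
  have h3 := aux (fun x => signedArea x.1 x.2.1 g) (by unfold signedArea; fun_prop)
    (by simp only [signedArea, g]; ring)
  have h4 : ∀ᶠ x in 𝓝 (u, v, w), D x ≠ 0 := hD.continuousAt.eventually_ne h
  filter_upwards [h1, h2, h3, h4] with x h1 h2 h3 h4 s hs hx1 hx2 hx3
  have := hs.three_mem hx1 hx2 hx3 h1.le h2.le h3.le (by
    rw [← add_div, ← add_div, div_eq_one_iff_eq h4]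
    simp only [D, signedArea]
    ring)
  convert this using 1
  have h4' : D x = (x.2.1.1 - x.1.1) * (x.2.2.2 - x.1.2) - (x.2.1.2 - x.1.2) * (x.2.2.1 - x.1.1) :=
    rfl
  rw [← sub_eq_zero]
  apply Prod.ext
  · simp only [Prod.fst_sub, Prod.fst_add, Prod.smul_fst, Prod.fst_zero, smul_eq_mul]
    field_simp
    rw [h4']
    simp only [signedArea, g]
    ring
  · simp only [Prod.snd_sub, Prod.snd_add, Prod.smul_snd, Prod.snd_zero, smul_eq_mul]
    field_simp
    rw [h4']
    simp only [signedArea, g]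
    ring

namespace IsConvexDecomposition

variable {M : Type*} [MetricSpace M] {P : ℝ × ℝ → M}

theorem shrinks_fiber (hP : IsConvexDecomposition P) (o : ℝ × ℝ) :
    ∀ e > 0, Shrinks P (fun p q => ‖p - q‖) e {q | P q = P o} := by
  let c : ℝ → ℝ × ℝ → ℝ × ℝ := fun θ p => o + θ • (p - o)
  have hc : Continuous fun p : ℝ × (ℝ × ℝ) => c p.1 p.2 := by fun_prop
  obtain ⟨K, hK, d, hd, hKd⟩ := hP.exists_isCompact (hP.isCompact_fiber o)
  obtain ⟨B, hB⟩ := (hK.image (f := fun p => p - o) (by fun_prop)).isBounded.exists_norm_le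
  refine Shrinks.of_family hP.continuous (fun _ => c) (fun _ => hc) (fun _ p => ?_)
    (fun _ a b p => ?_) ?_ (fun p => p) o (fun _ θ p => rfl) hd (B := B) ?_
  · simp [c]
  · simp only [c]
    module
  · intro δ hδ
    have hPc := hP.continuous
    have hcont : ∀ p, Continuous fun θ => dist (P (c θ p)) (P p) := fun p =>
      (hPc.comp (hc.comp (continuous_id.prodMk continuous_const))).dist continuous_const
    obtain ⟨δ', hδ', h⟩ := hP.robust (hP.isCompact_fiber o)
      (fun p _ => sSup ((fun θ => dist (P (c θ p)) (P p)) '' Icc (0 : ℝ) 1)) (by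
        refine isCompact_Icc.continuous_sSup
          (f := fun (x : (ℝ × ℝ) × (ℝ × ℝ)) θ => dist (P (c θ x.1)) (P x.1)) ?_
        simp only [c]
        fun_prop) δ (by
        intro k hk p q hp hq
        refine (csSup_le (a := 0) (Nonempty.image _ ⟨1, by simp⟩) ?_).trans_lt hδ
        rintro _ ⟨θ, hθ, rfl⟩
        have hpo : P p = P o := hp.trans hk
        have : c θ p ∈ {q | P q = P o} :=
          (hP.convex o).add_smul_sub_mem rfl hpo hθ
        dsimp only
        rw [show P (c θ p) = P o from this, hpo, dist_self])
    refine ⟨δ', hδ', Eventually.of_forall fun n p k hk hpk θ hθ => ?_⟩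
    refine (le_csSup ?_ (mem_image_of_mem _ hθ)).trans_lt (h k hk p p hpk hpk)
    exact (isCompact_Icc.image (hcont p)).bddAbove
  · exact fun p k hk hpk => hB _ ⟨p, hKd p k hk hpk, rfl⟩

/-- The points of `A` whose class contains a triangle of area at least `α / 2`. -/
def fat (P : ℝ × ℝ → M) (A : Set (ℝ × ℝ)) (α : ℝ) : Set (ℝ × ℝ) :=
  {p ∈ A | ∃ u v w, P u = P p ∧ P v = P p ∧ P w = P p ∧ α ≤ |signedArea u v w|}

theorem shrinks_fat (hP : IsConvexDecomposition P) {A : Set (ℝ × ℝ)} (hA : IsCompact A)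
    (hsat : ∀ p q, P p = P q → p ∈ A → q ∈ A) {α : ℝ} (hα : 0 < α) :
    ∀ e > 0, Shrinks P (fun p q => ‖p - q‖) e (fat P A α) := by
  classical
  have hPc := hP.continuous
  let T : Set ((ℝ × ℝ) × (ℝ × ℝ) × (ℝ × ℝ)) := (A ×ˢ (A ×ˢ A)) ∩
    {x | P x.1 = P x.2.1 ∧ P x.1 = P x.2.2 ∧ α ≤ |signedArea x.1 x.2.1 x.2.2|}
  have hT : IsCompact T := by
    refine (hA.prod (hA.prod hA)).inter_right ?_
    refine IsClosed.and (isClosed_eq (by fun_prop) (by fun_prop)) (IsClosed.and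
      (isClosed_eq (by fun_prop) (by fun_prop)) (isClosed_le (by fun_prop) ?_))
    unfold signedArea
    fun_prop
  have hloc : ∀ x ∈ T, ∃ U ∈ 𝓝 x, ∀ y ∈ T, y ∈ U → P y.1 = P x.1 := by
    rintro ⟨u, v, w⟩ ⟨-, h1, h2, h3⟩
    obtain ⟨g, hg⟩ := exists_common_point (u := u) (v := v) (w := w)
      (abs_pos.1 (hα.trans_le h3))
    refine ⟨_, hg, fun y hy hyU => ?_⟩
    have e1 := hyU _ (hP.convex y.1) rfl hy.2.1.symm hy.2.2.1.symm
    have e2 := hg.self_of_nhds _ (hP.convex u) rfl h1.symm h2.symm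
    exact e1.symm.trans e2
  choose! U hU hUT using hloc
  obtain ⟨t, htT, htU⟩ := hT.elim_nhds_subcover U hU
  have heq : fat P A α = ⋃ x ∈ t, {q | P q = P x.1} := by
    ext p
    simp only [mem_iUnion, mem_ofPred_eq, exists_prop]
    constructor
    · rintro ⟨hpA, u, v, w, hu, hv, hw, huvw⟩
      have hyT : (u, v, w) ∈ T := ⟨⟨hsat _ _ hu.symm hpA, hsat _ _ hv.symm hpA,
        hsat _ _ hw.symm hpA⟩, hu.trans hv.symm, hu.trans hw.symm, huvw⟩
      obtain ⟨x, hx, hyx⟩ := mem_iUnion₂.1 (htU hyT)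
      exact ⟨x, hx, hu.symm.trans (hUT x (htT x hx) _ hyT hyx)⟩
    · rintro ⟨x, hx, hpx⟩
      obtain ⟨⟨hx1, -⟩, h1, h2, h3⟩ := htT x hx
      exact ⟨hsat _ _ hpx.symm hx1, x.1, x.2.1, x.2.2, hpx.symm, h1.symm.trans hpx.symm,
        h2.symm.trans hpx.symm, h3⟩
  rw [heq]
  exact Shrinks.biUnion t _ fun x _ => hP.shrinks_fiber x.1

end IsConvexDecomposition

section Preorder

variable {X : Type*} [TopologicalSpace X] {R : X → X → Prop}

theorem Urysohns.CU.lim_mono_of_lower (c : Urysohns.CU fun _ u : Set X =>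
    ∀ x y, R x y → y ∈ u → x ∈ u) {x y : X} (hxy : R x y) : c.lim x ≤ c.lim y := by
  have key : ∀ n, ∀ c : Urysohns.CU fun _ u : Set X => ∀ x y, R x y → y ∈ u → x ∈ u,
      c.approx n x ≤ c.approx n y := by
    intro n
    induction n with
    | zero =>
      intro c
      by_cases hy : y ∈ c.U
      · rw [Urysohns.CU.approx, indicator_of_notMem (by simpa using c.P_C_U x y hxy hy)]
        exact Urysohns.CU.approx_nonneg _ _ _
      · rw [c.approx_of_notMem_U 0 hy]
        exact Urysohns.CU.approx_le_one _ _ _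
    | succ n ih =>
      intro c
      rw [Urysohns.CU.approx, Urysohns.CU.approx]
      exact midpoint_le_midpoint (ih _) (ih _)
  exact ciSup_le fun n => (key n c).trans (c.approx_le_lim y n)

variable [CompactSpace X] [T2Space X]

theorem exists_continuous_monotone_separating (hrefl : ∀ x, R x x)
    (htrans : ∀ x y z, R x y → R y z → R x z) (hclosed : IsClosed {p : X × X | R p.1 p.2})
    {a b : X} (hab : ¬ R b a) :
    ∃ f : X → ℝ, Continuous f ∧ (∀ x y, R x y → f x ≤ f y) ∧ (∀ x, f x ∈ Icc (0 : ℝ) 1) ∧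
      f a < f b := by
  have hup : ∀ C : Set X, IsClosed C → IsClosed {p | ∃ q ∈ C, R q p} := by
    intro C hC
    have : {p | ∃ q ∈ C, R q p} = Prod.snd '' ({p : X × X | R p.1 p.2} ∩ Prod.fst ⁻¹' C) := by
      ext p
      simp only [mem_ofPred_eq, mem_image, mem_inter_iff, mem_preimage, Prod.exists]
      constructor
      · rintro ⟨q, hq, hqp⟩
        exact ⟨q, p, ⟨hqp, hq⟩, rfl⟩
      · rintro ⟨q, p, ⟨hqp, hq⟩, rfl⟩
        exact ⟨q, hq, hqp⟩
    rw [this]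
    exact isClosedMap_snd_of_compactSpace _ (hclosed.inter (hC.preimage continuous_fst))
  have hdown : ∀ C : Set X, IsClosed C → IsClosed {p | ∃ q ∈ C, R p q} := by
    intro C hC
    have : {p | ∃ q ∈ C, R p q} = Prod.fst '' ({p : X × X | R p.1 p.2} ∩ Prod.snd ⁻¹' C) := by
      ext p
      simp only [mem_ofPred_eq, mem_image, mem_inter_iff, mem_preimage, Prod.exists]
      constructor
      · rintro ⟨q, hq, hqp⟩
        exact ⟨p, q, ⟨hqp, hq⟩, rfl⟩
      · rintro ⟨p, q, ⟨hqp, hq⟩, rfl⟩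
        exact ⟨q, hq, hqp⟩
    rw [this]
    exact isClosedMap_fst_of_compactSpace _ (hclosed.inter (hC.preimage continuous_snd))
  let c : Urysohns.CU fun _ u : Set X => ∀ x y, R x y → y ∈ u → x ∈ u :=
    { C := {a}
      U := {p | ∃ q ∈ ({b} : Set X), R q p}ᶜ
      P_C_U := by
        rintro x y hxy hy ⟨q, hq, hqx⟩
        exact hy ⟨q, hq, htrans _ _ _ hqx hxy⟩
      closed_C := isClosed_singleton
      open_U := (hup _ isClosed_singleton).isOpen_compl
      subset := by
        rintro x rfl ⟨q, rfl, hq⟩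
        exact hab hq
      hP := by
        intro c u hc hu huo hcu
        obtain ⟨N, hNo, hcN, hNu⟩ := normal_exists_closure_subset (hdown c hc) huo (by
          rintro p ⟨q, hq, hpq⟩
          exact hu p q hpq (hcu hq))
        refine ⟨{p | ∃ q ∈ Nᶜ, R q p}ᶜ, (hup _ hNo.isClosed_compl).isOpen_compl, ?_, ?_, ?_, hu⟩
        · rintro x hx ⟨q, hq, hqx⟩
          exact hq (hcN ⟨x, hx, hqx⟩)
        · refine (closure_mono ?_).trans hNu
          intro x hx
          by_contra hxN
          exact hx ⟨x, hxN, hrefl x⟩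
        · rintro x y hxy hy ⟨q, hq, hqx⟩
          exact hy ⟨q, hq, htrans _ _ _ hqx hxy⟩ }
  refine ⟨c.lim, c.continuous_lim, fun x y hxy => c.lim_mono_of_lower hxy, c.lim_mem_Icc, ?_⟩
  rw [c.lim_of_mem_C a rfl, c.lim_of_notMem_U b (by
    intro h
    exact h ⟨b, rfl, hrefl b⟩)]
  exact one_pos

/-- Nachbin's theorem: a closed preorder on a compact metrizable space is refined by a continuous
utility function. -/
theorem exists_continuous_strictly_monotone [SecondCountableTopology X] (hrefl : ∀ x, R x x)
    (htrans : ∀ x y z, R x y → R y z → R x z) (hclosed : IsClosed {p : X × X | R p.1 p.2}) :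
    ∃ f : X → ℝ, Continuous f ∧ (∀ x y, R x y → f x ≤ f y) ∧
      ∀ x y, R x y → ¬ R y x → f x < f y := by
  let I := {f : X → ℝ // Continuous f ∧ (∀ x y, R x y → f x ≤ f y) ∧ ∀ x, f x ∈ Icc (0 : ℝ) 1}
  have : Nonempty I := ⟨⟨fun _ => 0, continuous_const, fun _ _ _ => le_rfl, fun _ => by simp⟩⟩
  obtain ⟨T, hT, hTU⟩ := TopologicalSpace.isOpen_iUnion_countable
    (fun f : I => {p : X × X | f.1 p.1 < f.1 p.2}) fun f =>
      isOpen_lt (f.2.1.comp continuous_fst) (f.2.1.comp continuous_snd)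
  obtain ⟨g, hg⟩ : ∃ g : ℕ → I, T ⊆ range g := by
    rcases T.eq_empty_or_nonempty with rfl | hne
    · exact ⟨fun _ => Classical.arbitrary I, empty_subset _⟩
    · obtain ⟨g, hg⟩ := hT.exists_eq_range hne
      exact ⟨g, hg.le⟩
  have hbd : ∀ n x, ‖(1 / 2 : ℝ) ^ n * (g n).1 x‖ ≤ (1 / 2 : ℝ) ^ n := by
    intro n x
    have := (g n).2.2.2 x
    rw [norm_mul, Real.norm_of_nonneg (by positivity), Real.norm_of_nonneg this.1]
    exact mul_le_of_le_one_right (by positivity) this.2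
  have hsum : ∀ x, Summable fun n => (1 / 2 : ℝ) ^ n * (g n).1 x := fun x =>
    Summable.of_norm_bounded summable_geometric_two fun n => hbd n x
  have hterm : ∀ x y, R x y → ∀ n, (1 / 2 : ℝ) ^ n * (g n).1 x ≤ (1 / 2 : ℝ) ^ n * (g n).1 y :=
    fun x y hxy n => mul_le_mul_of_nonneg_left ((g n).2.2.1 x y hxy) (by positivity)
  refine ⟨fun x => ∑' n, (1 / 2 : ℝ) ^ n * (g n).1 x, ?_, ?_, ?_⟩
  · exact continuous_tsum (fun n => continuous_const.mul (g n).2.1) summable_geometric_two hbd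
  · exact fun x y hxy => (hsum x).tsum_le_tsum (hterm x y hxy) (hsum y)
  · intro x y hxy hyx
    obtain ⟨f, hf1, hf2, hf3, hf4⟩ := exists_continuous_monotone_separating hrefl htrans hclosed hyx
    have hmem : (x, y) ∈ ⋃ f : I, {p : X × X | f.1 p.1 < f.1 p.2} :=
      mem_iUnion.2 ⟨⟨f, hf1, hf2, hf3⟩, hf4⟩
    rw [← hTU] at hmem
    obtain ⟨f', hf'T, hf'⟩ := mem_iUnion₂.1 hmem
    obtain ⟨n, rfl⟩ := hg hf'T
    exact Summable.tsum_lt_tsum (hterm x y hxy) (mul_lt_mul_of_pos_left hf' (by positivity))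
      (hsum x) (hsum y)

end Preorder

namespace IsConvexDecomposition

variable {M : Type*} [MetricSpace M] {P : ℝ × ℝ → M}

theorem eq_of_segment (hP : IsConvexDecomposition P) {p q : ℝ × ℝ} (h : P p = P q) {t : ℝ}
    (ht : t ∈ Icc (0 : ℝ) 1) : P (p + t • (q - p)) = P p :=
  (hP.convex p).add_smul_sub_mem rfl h.symm ht

theorem eq_of_vertical (hP : IsConvexDecomposition P) {p q z : ℝ × ℝ} (h : P p = P q)
    (h1 : z.1 = p.1) (h2 : z.1 = q.1) (h3 : p.2 ≤ z.2) (h4 : z.2 ≤ q.2) : P z = P p := by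
  rcases (h3.trans h4).eq_or_lt with h5 | h5
  · rw [show z = p from Prod.ext h1 (by linarith)]
  · have hpos : 0 < q.2 - p.2 := by linarith
    rw [← hP.eq_of_segment h (t := (z.2 - p.2) / (q.2 - p.2))
      ⟨div_nonneg (by linarith) hpos.le, (div_le_one hpos).2 (by linarith)⟩]
    congr 1
    refine Prod.ext ?_ ?_
    · simp [← h1, ← h2]
    · simp only [Prod.snd_add, Prod.smul_snd, Prod.snd_sub, smul_eq_mul]
      field_simp
      ring

theorem eq_of_crossing (hP : IsConvexDecomposition P) {p p' q q' : ℝ × ℝ} (hp : P p = P p')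
    (hq : P q = P q') (h1 : p.1 = q.1) (h2 : p'.1 = q'.1) (h3 : p.2 ≤ q.2) (h4 : q'.2 ≤ p'.2) :
    P p = P q := by
  rcases h3.eq_or_lt with h5 | h5
  · rw [show p = q from Prod.ext h1 h5]
  · have hpos : 0 < (q.2 - p.2) + (p'.2 - q'.2) := by linarith
    have ht : (q.2 - p.2) / ((q.2 - p.2) + (p'.2 - q'.2)) ∈ Icc (0 : ℝ) 1 :=
      ⟨div_nonneg (by linarith) hpos.le, (div_le_one hpos).2 (by linarith)⟩
    rw [← hP.eq_of_segment hp ht, ← hP.eq_of_segment hq ht]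
    congr 1
    refine Prod.ext ?_ ?_
    · simp [h1, h2]
    · simp only [Prod.snd_add, Prod.smul_snd, Prod.snd_sub, smul_eq_mul]
      field_simp
      ring

/-- The class of `k` does not lie above the class of `l` along the line `x = a`. -/
def BelowOn (P : ℝ × ℝ → M) (a : ℝ) (k l : ℝ × ℝ) : Prop :=
  ∃ b b' : ℝ × ℝ, P b = P k ∧ P b' = P l ∧ b.1 = a ∧ b'.1 = a ∧ b.2 ≤ b'.2

section

variable {a : ℝ} {k l m : ℝ × ℝ}

theorem BelowOn.trans (hP : IsConvexDecomposition P) (h : BelowOn P a k l)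
    (h' : BelowOn P a l m) : BelowOn P a k m := by
  obtain ⟨b, b', hb, hb', h1, h2, h3⟩ := h
  obtain ⟨c, c', hc, hc', h4, h5, h6⟩ := h'
  rcases le_or_gt b.2 c'.2 with h7 | h7
  · exact ⟨b, c', hb, hc', h1, h5, h7⟩
  · have e1 : P b = P c := hP.eq_of_vertical (hc.trans hb'.symm) (by linarith) (by linarith)
      (by linarith) h3
    have e2 : P c' = P c := hP.eq_of_vertical (hc.trans hb'.symm) (by linarith) (by linarith)
      h6 (by linarith)
    exact ⟨b, b, hb, e1.trans (e2.symm.trans hc'), h1, h1, le_rfl⟩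

theorem BelowOn.eq (hP : IsConvexDecomposition P) (h : BelowOn P a k l) (h' : BelowOn P a l k) :
    P k = P l := by
  obtain ⟨b, b', hb, hb', h1, h2, h3⟩ := h
  obtain ⟨c, c', hc, hc', h4, h5, h6⟩ := h'
  rw [← hb, ← hb']
  exact hP.eq_of_crossing (hb.trans hc'.symm) (hb'.trans hc.symm) (by linarith) (by linarith) h3 h6

theorem belowOn_of_vertical (hP : IsConvexDecomposition P) (hk : ∃ b, P b = P k ∧ b.1 = a)
    (hl : ∃ b, P b = P l ∧ b.1 = a) (h1 : k.1 = l.1) (h2 : k.2 ≤ l.2) : BelowOn P a k l := by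
  obtain ⟨b, hb, hba⟩ := hk
  obtain ⟨c, hc, hca⟩ := hl
  rcases le_total b.2 c.2 with h | h
  · exact ⟨b, c, hb, hc, hba, hca, h⟩
  · have := hP.eq_of_crossing hb.symm hc.symm h1 (by linarith) h2 h
    exact ⟨b, b, hb, hb.trans this, hba, hba, le_rfl⟩

end

/-- The preorder generated by the vertical order and by the order along `x = a` of the classes
contained in `A`. -/
def HairOrder (P : ℝ × ℝ → M) (A : Set (ℝ × ℝ)) (a : ℝ) (p q : ℝ × ℝ) : Prop :=
  (p.1 = q.1 ∧ p.2 ≤ q.2) ∨ ∃ k ∈ A, ∃ l ∈ A, p.1 = k.1 ∧ p.2 ≤ k.2 ∧ BelowOn P a k l ∧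
    l.1 = q.1 ∧ l.2 ≤ q.2

section

variable {A : Set (ℝ × ℝ)} {a : ℝ}

theorem HairOrder.trans (hP : IsConvexDecomposition P)
    (hline : ∀ k ∈ A, ∃ b, P b = P k ∧ b.1 = a) {p q r : ℝ × ℝ} (h : HairOrder P A a p q)
    (h' : HairOrder P A a q r) : HairOrder P A a p r := by
  rcases h with ⟨h1, h2⟩ | ⟨k, hk, l, hl, h1, h2, h3, h4, h5⟩
  · rcases h' with ⟨h3, h4⟩ | ⟨k, hk, l, hl, h3, h4, h5⟩
    · exact Or.inl ⟨h1.trans h3, h2.trans h4⟩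
    · exact Or.inr ⟨k, hk, l, hl, h1.trans h3, h2.trans h4, h5⟩
  · rcases h' with ⟨h6, h7⟩ | ⟨k', hk', l', hl', h6, h7, h8, h9⟩
    · exact Or.inr ⟨k, hk, l, hl, h1, h2, h3, h4.trans h6, h5.trans h7⟩
    · refine Or.inr ⟨k, hk, l', hl', h1, h2, ?_, h9⟩
      exact (h3.trans hP (belowOn_of_vertical hP (hline l hl) (hline k' hk') (h4.trans h6)
        (h5.trans h7))).trans hP h8

theorem isClosed_hairOrder (hP : IsConvexDecomposition P) (hA : IsCompact A)
    (hsat : ∀ p q, P p = P q → p ∈ A → q ∈ A) {X : Set (ℝ × ℝ)} (hX : IsCompact X) :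
    IsClosed {p : X × X | HairOrder P A a p.1 p.2} := by
  have hPc := hP.continuous
  let T : Set (((ℝ × ℝ) × (ℝ × ℝ)) × ((ℝ × ℝ) × (ℝ × ℝ)) × (ℝ × ℝ) × (ℝ × ℝ)) :=
    ((X ×ˢ X) ×ˢ ((A ×ˢ A) ×ˢ (A ×ˢ A))) ∩ {x | x.1.1.1 = x.2.1.1.1 ∧ x.1.1.2 ≤ x.2.1.1.2 ∧
      P x.2.2.1 = P x.2.1.1 ∧ P x.2.2.2 = P x.2.1.2 ∧ x.2.2.1.1 = a ∧ x.2.2.2.1 = a ∧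
      x.2.2.1.2 ≤ x.2.2.2.2 ∧ x.2.1.2.1 = x.1.2.1 ∧ x.2.1.2.2 ≤ x.1.2.2}
  have hT : IsCompact T := by
    refine ((hX.prod hX).prod ((hA.prod hA).prod (hA.prod hA))).inter_right ?_
    refine IsClosed.and (isClosed_eq (by fun_prop) (by fun_prop)) ?_
    refine IsClosed.and (isClosed_le (by fun_prop) (by fun_prop)) ?_
    refine IsClosed.and (isClosed_eq (by fun_prop) (by fun_prop)) ?_
    refine IsClosed.and (isClosed_eq (by fun_prop) (by fun_prop)) ?_
    refine IsClosed.and (isClosed_eq (by fun_prop) (by fun_prop)) ?_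
    refine IsClosed.and (isClosed_eq (by fun_prop) (by fun_prop)) ?_
    refine IsClosed.and (isClosed_le (by fun_prop) (by fun_prop)) ?_
    exact IsClosed.and (isClosed_eq (by fun_prop) (by fun_prop))
      (isClosed_le (by fun_prop) (by fun_prop))
  have hT' : IsClosed (Prod.fst '' T) := (hT.image continuous_fst).isClosed
  have heq : {p : X × X | HairOrder P A a p.1 p.2} =
      {p : X × X | (p.1 : ℝ × ℝ).1 = (p.2 : ℝ × ℝ).1 ∧ (p.1 : ℝ × ℝ).2 ≤ (p.2 : ℝ × ℝ).2} ∪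
      (fun p : X × X => ((p.1 : ℝ × ℝ), (p.2 : ℝ × ℝ))) ⁻¹' (Prod.fst '' T) := by
    ext ⟨p, q⟩
    constructor
    · rintro (h | ⟨k, hk, l, hl, h1, h2, ⟨b, b', h3, h4, h5, h6, h7⟩, h8, h9⟩)
      · exact Or.inl h
      · refine Or.inr ⟨((p, q), (k, l), b, b'), ⟨⟨⟨p.2, q.2⟩, ⟨hk, hl⟩, ?_, ?_⟩, ?_⟩, rfl⟩
        · exact hsat _ _ h3.symm hk
        · exact hsat _ _ h4.symm hl
        · exact ⟨h1, h2, h3, h4, h5, h6, h7, h8, h9⟩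
    · rintro (h | ⟨⟨⟨p', q'⟩, ⟨k, l⟩, b, b'⟩, ⟨⟨-, ⟨hk, hl⟩, -⟩, h1, h2, h3, h4, h5, h6, h7, h8, h9⟩,
        heq⟩)
      · exact Or.inl h
      · obtain ⟨rfl, rfl⟩ := Prod.mk.inj heq
        exact Or.inr ⟨k, hk, l, hl, h1, h2, ⟨b, b', h3, h4, h5, h6, h7⟩, h8, h9⟩
  rw [heq]
  refine IsClosed.union ?_ (hT'.preimage (by fun_prop))
  exact IsClosed.and (isClosed_eq (by fun_prop) (by fun_prop))
    (isClosed_le (by fun_prop) (by fun_prop))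

theorem eq_of_hairOrder (hP : IsConvexDecomposition P)
    (hline : ∀ k ∈ A, ∃ b, P b = P k ∧ b.1 = a) {w z : ℝ × ℝ} (hw : w ∈ A) (h1 : z.1 = w.1)
    (h : HairOrder P A a z w) (h' : HairOrder P A a w z) : P z = P w := by
  have vert := fun {k l} (hk : k ∈ A) (hl : l ∈ A) => belowOn_of_vertical hP (hline k hk)
    (hline l hl)
  rcases le_total w.2 z.2 with h2 | h2
  · rcases h with ⟨-, h3⟩ | ⟨k, hk, l, hl, h3, h4, h5, h6, h7⟩
    · rw [show z = w from Prod.ext h1 (le_antisymm h3 h2)]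
    · have e1 := vert hw hk (h1.symm.trans h3) (h2.trans h4)
      have e2 := h5.trans hP (vert hl hw h6 h7)
      exact hP.eq_of_vertical (e1.eq hP e2) h1 h3 h2 h4
  · rcases h' with ⟨-, h3⟩ | ⟨k, hk, l, hl, h3, h4, h5, h6, h7⟩
    · rw [show z = w from Prod.ext h1 (le_antisymm h2 h3)]
    · have e1 := vert hl hw (h6.trans h1) (h7.trans h2)
      have e2 := (vert hw hk h3 h4).trans hP h5
      rw [hP.eq_of_vertical (e1.eq hP e2) h6.symm h1 h7 h2, e1.eq hP e2]

/-- There is a height function, monotone on vertical lines, that is constant on the classes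
contained in `A` and separates such a class from all other points on the vertical lines it meets. -/
theorem exists_height (hP : IsConvexDecomposition P) (hA : IsCompact A)
    (hsat : ∀ p q, P p = P q → p ∈ A → q ∈ A)
    (hline : ∀ k ∈ A, ∃ b, P b = P k ∧ b.1 = a) :
    ∃ g : ℝ × ℝ → ℝ, Continuous g ∧ (∀ x, Monotone fun y => g (x, y)) ∧
      (∃ B, ∀ z, |g z - z.2| ≤ B) ∧ (∀ p ∈ A, ∀ q, P q = P p → g q = g p) ∧
      ∀ w ∈ A, ∀ z : ℝ × ℝ, z.1 = w.1 → g z = g w → P z = P w := by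
  obtain ⟨B, hB⟩ := hA.isBounded.exists_norm_le
  wlog hB0 : 0 ≤ B generalizing B
  · exact this 0 (fun x hx => (hB x hx).trans (not_le.1 hB0).le) le_rfl
  have hBx : ∀ p ∈ A, p.1 ∈ Icc (-B) B := fun p hp =>
    abs_le.1 ((norm_fst_le p).trans (hB p hp))
  have hBy : ∀ p ∈ A, p.2 ∈ Icc (-B) B := fun p hp =>
    abs_le.1 ((norm_snd_le p).trans (hB p hp))
  have hBB : -B ≤ B := by linarith
  let X : Set (ℝ × ℝ) := Icc (-B) B ×ˢ Icc (-B) B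
  have hX : IsCompact X := isCompact_Icc.prod isCompact_Icc
  have : CompactSpace X := isCompact_iff_compactSpace.1 hX
  obtain ⟨f, hf, hfmono, hfstrict⟩ := exists_continuous_strictly_monotone
    (R := fun p q : X => HairOrder P A a p q) (fun p => Or.inl ⟨rfl, le_rfl⟩)
    (fun p q r h h' => h.trans hP hline h') (hP.isClosed_hairOrder hA hsat hX)
  let cl : ℝ → ℝ := fun t => projIcc (-B) B hBB t
  have hcl : Continuous cl := continuous_subtype_val.comp continuous_projIcc
  have hclmem : ∀ t, cl t ∈ Icc (-B) B := fun t => (projIcc (-B) B hBB t).2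
  have hcleq : ∀ t ∈ Icc (-B) B, cl t = t := fun t ht => by
    simp only [cl, projIcc_of_mem hBB ht]
  have hclhi : ∀ t, B ≤ t → cl t = B := fun t ht => by
    simp only [cl, projIcc_of_right_le hBB ht]
  have hcllo : ∀ t, t ≤ -B → cl t = -B := fun t ht => by
    simp only [cl, projIcc_of_le_left hBB ht]
  have hclmono : Monotone cl := fun s t hst => (monotone_projIcc hBB) hst
  have hclsub : ∀ s t, s ≤ t → s - cl s ≤ t - cl t := by
    intro s t hst
    have h1 := (hclmem s)
    have h2 := (hclmem t)
    rcases le_total t B with ht | ht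
    · rcases le_total (-B) s with hs | hs
      · rw [hcleq s ⟨hs, hst.trans ht⟩, hcleq t ⟨hs.trans hst, ht⟩]
        linarith
      · rw [hcllo s hs]
        rcases le_total (-B) t with ht' | ht'
        · rw [hcleq t ⟨ht', ht⟩]
          linarith
        · rw [hcllo t ht']
          linarith
    · rw [hclhi t ht]
      rcases le_total (-B) s with hs | hs
      · rcases le_total s B with hs' | hs'
        · rw [hcleq s ⟨hs, hs'⟩]
          linarith
        · rw [hclhi s hs']
          linarith
      · rw [hcllo s hs]
        linarith
  let pt : ℝ × ℝ → X := fun z => ⟨(cl z.1, cl z.2), hclmem _, hclmem _⟩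
  have hpt : Continuous pt := by
    refine Continuous.subtype_mk ?_ _
    fun_prop
  have hptA : ∀ p ∈ A, (pt p : ℝ × ℝ) = p := fun p hp =>
    Prod.ext (hcleq _ (hBx p hp)) (hcleq _ (hBy p hp))
  let g : ℝ × ℝ → ℝ := fun z => f (pt z) + (z.2 - cl z.2)
  have hg : Continuous g := by fun_prop
  have hgA : ∀ p ∈ A, g p = f (pt p) := fun p hp => by
    simp only [g, hcleq _ (hBy p hp)]
    ring
  obtain ⟨Bf, hBf⟩ := (isCompact_range hf).isBounded.exists_norm_le
  refine ⟨g, hg, ?_, ⟨Bf + B, ?_⟩, ?_, ?_⟩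
  · intro x y y' hyy'
    exact add_le_add (hfmono _ _ (Or.inl ⟨rfl, hclmono hyy'⟩)) (hclsub _ _ hyy')
  · intro z
    have e : g z - z.2 = f (pt z) - cl z.2 := by simp only [g]; ring
    rw [e]
    exact (abs_sub _ _).trans (add_le_add (hBf _ ⟨_, rfl⟩) (abs_le.2 (hclmem _)))
  · intro p hp q hqp
    have hq : q ∈ A := hsat _ _ hqp.symm hp
    rw [hgA p hp, hgA q hq]
    have aux : ∀ p ∈ A, ∀ q ∈ A, P q = P p → f (pt q) ≤ f (pt p) := by
      intro p hp q hq hqp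
      obtain ⟨b, hb, hba⟩ := hline q hq
      refine hfmono _ _ ?_
      rw [hptA p hp, hptA q hq]
      exact Or.inr ⟨q, hq, p, hp, rfl, le_rfl, ⟨b, b, hb, hb.trans hqp, hba, hba, le_rfl⟩, rfl,
        le_rfl⟩
    exact le_antisymm (aux p hp q hq hqp) (aux q hq p hp hqp.symm)
  · intro w hw z hzw hgzw
    rw [hgA w hw] at hgzw
    have hx : cl z.1 = w.1 := by rw [hzw, hcleq _ (hBx w hw)]
    have hyw := hBy w hw
    rcases lt_or_ge B z.2 with hz | hz
    · have h1 : f (pt w) ≤ f (pt z) := hfmono _ _ (by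
        rw [hptA w hw]
        exact Or.inl ⟨hx.symm, by simpa only [pt, hclhi _ hz.le] using hyw.2⟩)
      have h2 : g z = f (pt z) + (z.2 - B) := by simp only [g, hclhi _ hz.le]
      linarith
    · rcases lt_or_ge z.2 (-B) with hz' | hz'
      · have h1 : f (pt z) ≤ f (pt w) := hfmono _ _ (by
          rw [hptA w hw]
          exact Or.inl ⟨hx, by simpa only [pt, hcllo _ hz'.le] using hyw.1⟩)
        have h2 : g z = f (pt z) + (z.2 - -B) := by simp only [g, hcllo _ hz'.le]
        linarith
      · have hptz : (pt z : ℝ × ℝ) = z :=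
          Prod.ext (hx.trans hzw.symm) (hcleq _ ⟨hz', hz⟩)
        have hfz : f (pt z) = f (pt w) := by
          rw [← hgzw]
          simp only [g, hcleq _ ⟨hz', hz⟩]
          ring
        have key : HairOrder P A a z w ∧ HairOrder P A a w z := by
          have i1 := hfstrict (pt z) (pt w)
          have i2 := hfstrict (pt w) (pt z)
          rw [hptz, hptA w hw] at i1 i2
          rcases le_total z.2 w.2 with h | h
          · have h1 : HairOrder P A a z w := Or.inl ⟨hzw, h⟩
            exact ⟨h1, by_contra fun hcon => (i1 h1 hcon).ne hfz⟩
          · have h1 : HairOrder P A a w z := Or.inl ⟨hzw.symm, h⟩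
            exact ⟨by_contra fun hcon => (i2 h1 hcon).ne hfz.symm, h1⟩
        exact hP.eq_of_hairOrder hline hw hzw key.1 key.2

end

end IsConvexDecomposition

/-- The horizontal contractions towards `x = a` along the level curves of perturbations of `g`. -/
theorem exists_hair_flow (g : ℝ × ℝ → ℝ) (hg : Continuous g)
    (hmono : ∀ x, Monotone fun y => g (x, y)) {B : ℝ} (hB : ∀ z, |g z - z.2| ≤ B) (a : ℝ) {ε : ℝ}
    (hε : 0 < ε) :
    ∃ c : ℝ → ℝ × ℝ → ℝ × ℝ, (Continuous fun p : ℝ × (ℝ × ℝ) => c p.1 p.2) ∧ (∀ p, c 1 p = p) ∧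
      (∀ s t p, c (s * t) p = c s (c t p)) ∧ (∀ θ p, (c θ p).1 = a + θ * (p.1 - a)) ∧
      ∀ θ p, g (c θ p) + (c θ p).2 * ε = g p + p.2 * ε := by
  have hstrict : ∀ x, StrictMono fun y => g (x, y) + y * ε := fun x =>
    (hmono x).add_strictMono (strictMono_id.mul_const hε)
  have hsurj : ∀ x, Function.Surjective fun y => g (x, y) + y * ε := by
    intro x
    refine Continuous.surjective (by fun_prop) ?_ ?_
    · refine tendsto_atTop_mono' _ ?_
        (tendsto_atTop_add_const_right _ (-B) tendsto_id)
      filter_upwards [eventually_ge_atTop 0] with y hy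
      have := (abs_le.1 (hB (x, y))).1
      have := mul_nonneg hy hε.le
      simp only [id]
      linarith
    · refine tendsto_atBot_mono' _ ?_
        (tendsto_atBot_add_const_right _ B tendsto_id)
      filter_upwards [eventually_le_atBot 0] with y hy
      have := (abs_le.1 (hB (x, y))).2
      have := mul_nonpos_of_nonpos_of_nonneg hy hε.le
      simp only [id]
      linarith
  obtain ⟨u, hu, hFu⟩ := exists_continuous_implicit (fun y x => g (x, y) + y * ε) (by fun_prop)
    hstrict hsurj
  have huniq : ∀ p : ℝ × ℝ, u (g p + p.2 * ε) p.1 = p.2 := fun p =>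
    (hstrict p.1).injective (hFu _ _)
  let c : ℝ → ℝ × ℝ → ℝ × ℝ := fun θ p =>
    (a + θ * (p.1 - a), u (g p + p.2 * ε) (a + θ * (p.1 - a)))
  have hcg : ∀ θ p, g (c θ p) + (c θ p).2 * ε = g p + p.2 * ε := fun θ p => hFu _ _
  refine ⟨c, ?_, fun p => ?_, fun s t p => ?_, fun θ p => rfl, hcg⟩
  · refine Continuous.prodMk (by fun_prop) ?_
    exact hu.comp (f := fun p : ℝ × (ℝ × ℝ) => (g p.2 + p.2.2 * ε, a + p.1 * (p.2.1 - a)))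
      (by fun_prop)
  · refine Prod.ext (by simp [c]) ?_
    simp only [c, one_mul, add_sub_cancel]
    exact huniq p
  · have h1 : a + s * t * (p.1 - a) = a + s * ((c t p).1 - a) := by
      simp only [c]
      ring
    refine Prod.ext h1 ?_
    change u _ (a + s * t * (p.1 - a)) = u (g (c t p) + (c t p).2 * ε) (a + s * ((c t p).1 - a))
    rw [hcg, h1]

namespace IsConvexDecomposition

variable {M : Type*} [MetricSpace M] {P : ℝ × ℝ → M}

theorem shrinks_fst_of_line (hP : IsConvexDecomposition P) {A : Set (ℝ × ℝ)} {a : ℝ}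
    (hA : IsCompact A) (hsat : ∀ p q, P p = P q → p ∈ A → q ∈ A)
    (hline : ∀ k ∈ A, ∃ b, P b = P k ∧ b.1 = a) :
    ∀ e > 0, Shrinks P (fun p q => ‖p.1 - q.1‖) e A := by
  obtain ⟨g, hg, hmono, ⟨B, hB⟩, hconst, hsep⟩ := hP.exists_height hA hsat hline
  have hB0 : 0 ≤ B := (abs_nonneg _).trans (hB 0)
  have hPc := hP.continuous
  have hsep' : ∀ p ∈ A, ∀ z : ℝ × ℝ, ∀ θ ∈ Icc (0 : ℝ) 1, z.1 = a + θ * (p.1 - a) → g z = g p →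
      P z = P p := by
    intro p hp z θ hθ hz hgz
    obtain ⟨b, hb, hba⟩ := hline p hp
    have h1 : P (b + θ • (p - b)) = P p := (hP.eq_of_segment hb hθ).trans hb
    rw [← h1]
    refine hsep _ (hsat _ _ h1.symm hp) z ?_ (hgz.trans (hconst p hp _ h1).symm)
    simp [hz, hba]
  choose c hc hone hmul hfst hlev using fun n : ℕ =>
    exists_hair_flow g hg hmono hB a (ε := 1 / ((n : ℝ) + 1)) (by positivity)
  have hbd : ∀ n θ p, |g (c n θ p) - g p| ≤ 2 * B * (1 / ((n : ℝ) + 1)) ∧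
      |(c n θ p).2 - p.2| ≤ 2 * B := by
    intro n θ p
    have hε : 0 < 1 / ((n : ℝ) + 1) := by positivity
    set ε := 1 / ((n : ℝ) + 1)
    have h1 := hlev n θ p
    have h2 := abs_le.1 (hB (c n θ p))
    have h3 := abs_le.1 (hB p)
    have h4 : |(c n θ p).2 - p.2| ≤ 2 * B := by
      have h5 : ((c n θ p).2 - p.2) * (1 + ε) =
          (g p - p.2) - (g (c n θ p) - (c n θ p).2) := by linarith
      have h6 : |(c n θ p).2 - p.2| * (1 + ε) ≤ 2 * B := by
        rw [← abs_of_pos (show 0 < 1 + ε by linarith), ← abs_mul, h5]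
        exact abs_le.2 ⟨by linarith, by linarith⟩
      nlinarith [abs_nonneg ((c n θ p).2 - p.2)]
    refine ⟨?_, h4⟩
    have h5 : g (c n θ p) - g p = -((c n θ p).2 - p.2) * ε := by linarith
    rw [h5, abs_mul, abs_neg, abs_of_pos hε]
    exact mul_le_mul_of_nonneg_right h4 hε.le
  obtain ⟨K, hK, d, hd, hKd⟩ := hP.exists_isCompact hA
  obtain ⟨C, hC⟩ := (hK.image (f := fun p : ℝ × ℝ => p.1 - a) (by fun_prop)).isBounded.exists_norm_le
  refine Shrinks.of_family hPc c hc hone hmul ?_ Prod.fst a (fun n θ p => hfst n θ p) hd (B := C)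
    fun p k hk hpk => hC _ ⟨p, hKd p k hk hpk, rfl⟩
  intro δ hδ
  let K' : Set (ℝ × ℝ) := cthickening (C + 2 * B) K
  have hK' : IsCompact K' := hK.cthickening
  let T : Set ((ℝ × ℝ) × (ℝ × ℝ) × (ℝ × ℝ) × ℝ) := (A ×ˢ (K ×ˢ (K' ×ˢ Icc (0 : ℝ) 1))) ∩
    {x | x.2.2.1.1 = a + x.2.2.2 * (x.2.1.1 - a) ∧ δ ≤ dist (P x.2.2.1) (P x.2.1)}
  have hT : IsCompact T := by
    refine (hA.prod (hK.prod (hK'.prod isCompact_Icc))).inter_right ?_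
    exact IsClosed.and (isClosed_eq (by fun_prop) (by fun_prop))
      (isClosed_le (by fun_prop) (by fun_prop))
  let Φ : (ℝ × ℝ) × (ℝ × ℝ) × (ℝ × ℝ) × ℝ → ℝ := fun x =>
    max (dist (P x.2.1) (P x.1)) |g x.2.2.1 - g x.2.1|
  have hΦ : Continuous Φ := by fun_prop
  obtain ⟨d', hd', hTd'⟩ : ∃ d > 0, ∀ x ∈ T, d ≤ Φ x := by
    rcases T.eq_empty_or_nonempty with hT0 | hT0
    · exact ⟨1, one_pos, by simp [hT0]⟩
    · obtain ⟨x, hx, hmin⟩ := hT.exists_isMinOn hT0 hΦ.continuousOn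
      refine ⟨Φ x, ?_, fun y hy => hmin hy⟩
      by_contra hcon
      obtain ⟨h1, h2⟩ := max_le_iff.1 (not_lt.1 hcon)
      have h3 : P x.2.1 = P x.1 := dist_le_zero.1 h1
      have h4 : g x.2.2.1 = g x.2.1 := by
        have := abs_nonpos_iff.1 h2
        linarith
      obtain ⟨⟨hx1, -, -, hx4⟩, hx5, hx6⟩ := hx
      have h5 := hsep' _ (hsat _ _ h3.symm hx1) _ _ hx4 hx5 h4
      rw [h5, dist_self] at hx6
      linarith
  have hlim : Tendsto (fun n : ℕ => 2 * B * (1 / ((n : ℝ) + 1))) atTop (𝓝 0) := by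
    simpa using tendsto_one_div_add_atTop_nhds_zero_nat.const_mul (2 * B)
  refine ⟨min d d', lt_min hd hd', ?_⟩
  filter_upwards [hlim.eventually_lt_const hd'] with n hn p k hk hpk θ hθ
  by_contra hcon
  have hpK := hKd p k hk (hpk.trans_le (min_le_left _ _))
  have hpC : |p.1 - a| ≤ C := hC _ ⟨p, hpK, rfl⟩
  have hC0 : 0 ≤ C := (abs_nonneg _).trans hpC
  have hmem : c n θ p ∈ K' := by
    refine mem_cthickening_of_dist_le _ p _ _ hpK ?_
    rw [Prod.dist_eq]
    refine max_le ?_ ?_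
    · rw [Real.dist_eq, hfst, show a + θ * (p.1 - a) - p.1 = (θ - 1) * (p.1 - a) by ring, abs_mul]
      have : |θ - 1| ≤ 1 := abs_le.2 ⟨by linarith [hθ.1], by linarith [hθ.2]⟩
      have := mul_le_of_le_one_left (abs_nonneg (p.1 - a)) this
      linarith
    · rw [Real.dist_eq]
      linarith [(hbd n θ p).2]
  have h1 := hTd' (k, p, c n θ p, θ) ⟨⟨hk, hpK, hmem, hθ⟩, hfst n θ p, not_lt.1 hcon⟩
  have h2 : Φ (k, p, c n θ p, θ) < d' :=
    max_lt (hpk.trans_le (min_le_right _ _)) ((hbd n θ p).1.trans_lt hn)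
  linarith

end IsConvexDecomposition

theorem Shrinks.swap {M : Type*} [MetricSpace M] {P : ℝ × ℝ → M} {e : ℝ} {A : Set (ℝ × ℝ)}
    (h : Shrinks (P ∘ Prod.swap) (fun p q => ‖p - q‖) e A) :
    Shrinks P (fun p q => ‖p - q‖) e (Prod.swap ⁻¹' A) := by
  intro δ hδ
  obtain ⟨f, h1, h2, d, hd, h3, h4⟩ := h δ hδ
  have hnorm : ∀ p q : ℝ × ℝ, ‖p.swap - q.swap‖ = ‖p - q‖ := fun p q => by
    simp [Prod.norm_def, max_comm]
  let g := ((Homeomorph.prodComm ℝ ℝ).trans f).trans (Homeomorph.prodComm ℝ ℝ)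
  have hg : ∀ p, g p = (f p.swap).swap := fun p => rfl
  refine ⟨g, fun p => ?_, fun p hp => ?_, d, hd, fun p q hpq => ?_, fun k hk p q hp hq => ?_⟩
  · simpa [hg] using h1 p.swap
  · obtain ⟨k, hk, hpk⟩ := h2 p.swap fun hcon => hp (by rw [hg, hcon, Prod.swap_swap])
    exact ⟨k.swap, by simpa using hk, by simpa using hpk⟩
  · have := h3 p.swap q.swap (by simpa using hpq)
    simp only [hg, hnorm] at this ⊢
    exact this
  · have := h4 k.swap hk p.swap q.swap (by simpa using hp) (by simpa using hq)
    simp only [hg, hnorm] at this ⊢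
    exact this

/-- The points of `A` whose class contains a segment of width at least `ε` that is closer to being
horizontal than to being vertical. -/
def wide {M : Type*} (P : ℝ × ℝ → M) (A : Set (ℝ × ℝ)) (ε : ℝ) : Set (ℝ × ℝ) :=
  {p ∈ A | ∃ u v : ℝ × ℝ, P u = P p ∧ P v = P p ∧ ε ≤ |u.1 - v.1| ∧ |u.2 - v.2| ≤ |u.1 - v.1|}

theorem wide_saturated {M : Type*} {P : ℝ × ℝ → M} {A : Set (ℝ × ℝ)}
    (hsat : ∀ p q, P p = P q → p ∈ A → q ∈ A) (ε : ℝ) :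
    ∀ p q, P p = P q → p ∈ wide P A ε → q ∈ wide P A ε := by
  rintro p q hpq ⟨hp, u, v, hu, hv, h⟩
  exact ⟨hsat _ _ hpq hp, u, v, hu.trans hpq, hv.trans hpq, h⟩

namespace IsConvexDecomposition

variable {M : Type*} [MetricSpace M] {P : ℝ × ℝ → M}

theorem swap (hP : IsConvexDecomposition P) : IsConvexDecomposition (P ∘ Prod.swap) where
  continuous := hP.continuous.comp continuous_swap
  convex p := by
    have := (hP.convex p.swap).linear_preimage (LinearEquiv.prodComm ℝ ℝ ℝ).toLinearMap
    exact this
  bounded C hC := by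
    obtain ⟨δ, hδ, h⟩ := hP.bounded (Prod.swap '' C) (by
      obtain ⟨r, hr⟩ := hC.exists_norm_le
      refine (isBounded_iff_forall_norm_le).2 ⟨r, ?_⟩
      rintro _ ⟨p, hp, rfl⟩
      simpa [Prod.norm_def, max_comm] using hr p hp)
    refine ⟨δ, hδ, ?_⟩
    obtain ⟨r, hr⟩ := h.exists_norm_le
    refine (isBounded_iff_forall_norm_le).2 ⟨r, ?_⟩
    rintro q ⟨p, hp, hqp⟩
    have := hr q.swap ⟨p.swap, ⟨p, hp, rfl⟩, hqp⟩
    simpa [Prod.norm_def, max_comm] using this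

theorem isCompact_wide (hP : IsConvexDecomposition P) {A : Set (ℝ × ℝ)} (hA : IsCompact A)
    (hsat : ∀ p q, P p = P q → p ∈ A → q ∈ A) (ε : ℝ) : IsCompact (wide P A ε) := by
  have hPc := hP.continuous
  let T : Set ((ℝ × ℝ) × (ℝ × ℝ) × (ℝ × ℝ)) := (A ×ˢ (A ×ˢ A)) ∩
    {x | P x.2.1 = P x.1 ∧ P x.2.2 = P x.1 ∧ ε ≤ |x.2.1.1 - x.2.2.1| ∧
      |x.2.1.2 - x.2.2.2| ≤ |x.2.1.1 - x.2.2.1|}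
  have hT : IsCompact T := by
    refine (hA.prod (hA.prod hA)).inter_right ?_
    exact IsClosed.and (isClosed_eq (by fun_prop) (by fun_prop))
      (IsClosed.and (isClosed_eq (by fun_prop) (by fun_prop))
      (IsClosed.and (isClosed_le (by fun_prop) (by fun_prop))
      (isClosed_le (by fun_prop) (by fun_prop))))
  convert hT.image continuous_fst
  ext p
  constructor
  · rintro ⟨hp, u, v, hu, hv, h⟩
    exact ⟨(p, u, v), ⟨⟨hp, hsat _ _ hu.symm hp, hsat _ _ hv.symm hp⟩, hu, hv, h⟩, rfl⟩
  · rintro ⟨⟨p, u, v⟩, ⟨⟨hp, -, -⟩, hu, hv, h⟩, rfl⟩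
    exact ⟨hp, u, v, hu, hv, h⟩

theorem shrinks_fst_of_wide (hP : IsConvexDecomposition P) {A : Set (ℝ × ℝ)} (hA : IsCompact A)
    (hsat : ∀ p q, P p = P q → p ∈ A → q ∈ A) {ε : ℝ} (hε : 0 < ε)
    (hwide : ∀ p ∈ A, ∃ u v : ℝ × ℝ, P u = P p ∧ P v = P p ∧ ε ≤ |u.1 - v.1|) :
    ∀ e > 0, Shrinks P (fun p q => ‖p.1 - q.1‖) e A := by
  have hmeets : ∀ p ∈ A, ∃ i : ℤ, ∃ b, P b = P p ∧ b.1 = i * ε := by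
    intro p hp
    obtain ⟨u, v, hu, hv, huv⟩ := hwide p hp
    wlog hle : u.1 ≤ v.1 generalizing u v
    · exact this v u hv hu (by rwa [abs_sub_comm]) (not_le.1 hle).le
    rw [abs_sub_comm, abs_of_nonneg (by linarith)] at huv
    have h1 : u.1 ≤ ⌈u.1 / ε⌉ * ε := by
      rw [← div_le_iff₀ hε]
      exact Int.le_ceil _
    have h2 : ⌈u.1 / ε⌉ * ε ≤ u.1 + ε := by
      have := Int.ceil_lt_add_one (u.1 / ε)
      calc (⌈u.1 / ε⌉ : ℝ) * ε ≤ (u.1 / ε + 1) * ε := mul_le_mul_of_nonneg_right this.le hε.le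
        _ = _ := by field_simp
    have hpos : 0 < v.1 - u.1 := by linarith
    refine ⟨⌈u.1 / ε⌉, _, (hP.eq_of_segment (hu.trans hv.symm)
      (t := (⌈u.1 / ε⌉ * ε - u.1) / (v.1 - u.1)) ⟨div_nonneg (by linarith) hpos.le,
        (div_le_one hpos).2 (by linarith)⟩).trans hu, ?_⟩
    simp only [Prod.fst_add, Prod.smul_fst, Prod.fst_sub, smul_eq_mul]
    field_simp
    ring
  obtain ⟨B, hB⟩ := hA.isBounded.exists_norm_le
  obtain ⟨N, hN⟩ := exists_nat_gt (B / ε)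
  rw [div_lt_iff₀ hε] at hN
  let K : ℤ → Set (ℝ × ℝ) := fun i => A ∩ P ⁻¹' (P '' (A ∩ {b | b.1 = i * ε}))
  have hK : A = ⋃ i ∈ Finset.Icc (-(N : ℤ)) N, K i := by
    refine Subset.antisymm (fun p hp => ?_) (iUnion₂_subset fun i _ => inter_subset_left)
    obtain ⟨i, b, hb, hbi⟩ := hmeets p hp
    have hbA := hsat _ _ hb.symm hp
    have h1 := abs_le.1 ((norm_fst_le b).trans (hB b hbA))
    rw [hbi] at h1
    refine mem_iUnion₂.2 ⟨i, Finset.mem_Icc.2 ⟨?_, ?_⟩, hp, b, ⟨hbA, hbi⟩, hb⟩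
    · by_contra hcon
      have : (i : ℝ) < -N := by exact_mod_cast not_le.1 hcon
      nlinarith
    · by_contra hcon
      have : (N : ℝ) < i := by exact_mod_cast not_le.1 hcon
      nlinarith
  rw [hK]
  refine Shrinks.biUnion _ _ fun i _ => hP.shrinks_fst_of_line (a := i * ε) ?_ ?_ ?_
  · have hc : IsCompact (A ∩ {b : ℝ × ℝ | b.1 = i * ε}) :=
      hA.inter_right (isClosed_eq continuous_fst continuous_const)
    exact hA.inter_right (hP.isCompact_saturation hc).isClosed
  · rintro p q hpq ⟨hp, b, hb, hbp⟩
    exact ⟨hsat _ _ hpq hp, b, hb, hbp.trans hpq⟩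
  · rintro k ⟨-, b, hb, hbk⟩
    exact ⟨b, hbk, hb.2⟩

theorem shrinks_norm_of_fst (hP : IsConvexDecomposition P) {A : Set (ℝ × ℝ)} (hA : IsCompact A)
    {e r r' : ℝ} (hr : 0 ≤ r') (hrr' : r < r') (h : Shrinks P (fun p q => ‖p.1 - q.1‖) e A)
    (hflat : ∀ k ∈ A, ∀ p q, P p = P k → P q = P k → |p.2 - q.2| ≤ |p.1 - q.1| + r) :
    Shrinks P (fun p q => ‖p - q‖) (e + r') A := by
  obtain ⟨d₀, hd₀, hrob⟩ := hP.robust hA (fun p q => |p.2 - q.2| - |p.1 - q.1|) (by fun_prop) r'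
    fun k hk p q hp hq => by
      have := hflat k hk p q hp hq
      linarith
  have hle : ∀ p q : ℝ × ℝ, |p.2 - q.2| - |p.1 - q.1| < r' → ‖p - q‖ ≤ |p.1 - q.1| + r' := by
    intro p q hpq
    rw [Prod.norm_def]
    refine max_le ?_ ?_
    · simpa using hr
    · simp only [Prod.snd_sub, Real.norm_eq_abs]
      linarith
  have hfst : ∀ p q : ℝ × ℝ, |p.1 - q.1| ≤ ‖p - q‖ := fun p q => norm_fst_le (p - q)
  intro δ hδ
  obtain ⟨f, f1, f2, d, hd, f3, f4⟩ := h (min δ (d₀ / 4)) (by positivity)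
  have f1' : ∀ p, dist (P (f p)) (P p) < d₀ / 4 := fun p => (f1 p).trans_le (min_le_right _ _)
  refine ⟨f, fun p => (f1 p).trans_le (min_le_left _ _), fun p hp => ?_, min d (d₀ / 4),
    by positivity, ?_, ?_⟩
  · obtain ⟨k, hk, hpk⟩ := f2 p hp
    exact ⟨k, hk, hpk.trans_le (min_le_left _ _)⟩
  · intro p q hpq
    have h3 : |(f p).1 - (f q).1| ≤ |p.1 - q.1| + e := f3 p q (hpq.trans_le (min_le_left _ _))
    have hpq' := hpq.trans_le (min_le_right _ _)
    have he : f p = p → f q = q → 0 ≤ e := fun hp hq => by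
      rw [hp, hq] at h3
      linarith
    have main : (∃ k ∈ A, dist (P (f p)) (P k) < d₀ ∧ dist (P (f q)) (P k) < d₀) →
        ‖f p - f q‖ ≤ ‖p - q‖ + (e + r') := by
      rintro ⟨k, hk, hp, hq⟩
      have := hle _ _ (hrob k hk _ _ hp hq)
      linarith [hfst p q]
    by_cases hp : f p = p
    · by_cases hq : f q = q
      · dsimp only
        rw [hp, hq]
        linarith [he hp hq]
      · obtain ⟨k, hk, hqk⟩ := f2 q hq
        have hqk' := hqk.trans_le (min_le_right _ _)
        refine main ⟨k, hk, ?_, ?_⟩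
        · rw [hp]
          linarith [dist_triangle (P p) (P q) (P k)]
        · linarith [dist_triangle (P (f q)) (P q) (P k), f1' q]
    · obtain ⟨k, hk, hpk⟩ := f2 p hp
      have hpk' := hpk.trans_le (min_le_right _ _)
      refine main ⟨k, hk, ?_, ?_⟩
      · linarith [dist_triangle (P (f p)) (P p) (P k), f1' p]
      · rw [dist_comm] at hpq'
        linarith [dist_triangle4 (P (f q)) (P q) (P p) (P k), f1' q]
  · intro k hk p q hp hq
    have h4 : |(f p).1 - (f q).1| ≤ e :=
      f4 k hk p q (hp.trans_le (min_le_left _ _)) (hq.trans_le (min_le_left _ _))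
    have hp' := hp.trans_le (min_le_right _ _)
    have hq' := hq.trans_le (min_le_right _ _)
    have := hle _ _ (hrob k hk (f p) (f q)
      (by linarith [dist_triangle (P (f p)) (P p) (P k), f1' p])
      (by linarith [dist_triangle (P (f q)) (P q) (P k), f1' q]))
    dsimp only
    linarith

theorem shrinks_wide (hP : IsConvexDecomposition P) {A : Set (ℝ × ℝ)} (hA : IsCompact A)
    (hsat : ∀ p q, P p = P q → p ∈ A → q ∈ A) {ε r e : ℝ} (hε : 0 < ε) (hr : 0 < r) (he : 0 < e)
    (hthin : ∀ p ∈ A, ∀ u v w, P u = P p → P v = P p → P w = P p →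
      |signedArea u v w| ≤ ε * r / 2) :
    Shrinks P (fun p q => ‖p - q‖) (e + 2 * r) (wide P A ε) := by
  refine hP.shrinks_norm_of_fst (r := r) (hP.isCompact_wide hA hsat ε) (by linarith) (by linarith)
    (hP.shrinks_fst_of_wide (hP.isCompact_wide hA hsat ε) (wide_saturated hsat ε) hε ?_ e he) ?_
  · rintro p ⟨-, u, v, hu, hv, h, -⟩
    exact ⟨u, v, hu, hv, h⟩
  · rintro k ⟨hk, u, v, hu, hv, h1, h2⟩ p q hp hq
    have h3 := hthin k hk u v p hu hv hp
    have h4 := hthin k hk u v q hu hv hq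
    have h5 : (u.1 - v.1) * (p.2 - q.2) =
        (u.2 - v.2) * (p.1 - q.1) + (signedArea u v q - signedArea u v p) := by
      simp only [signedArea]
      ring
    have h6 : |u.1 - v.1| * |p.2 - q.2| ≤ |u.1 - v.1| * (|p.1 - q.1| + r) := by
      rw [← abs_mul, h5]
      calc _ ≤ |(u.2 - v.2) * (p.1 - q.1)| + |signedArea u v q - signedArea u v p| :=
            abs_add_le _ _
        _ ≤ |u.1 - v.1| * |p.1 - q.1| + ε * r := by
            refine add_le_add ?_ ?_
            · rw [abs_mul]
              exact mul_le_mul_of_nonneg_right h2 (abs_nonneg _)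
            · exact (abs_sub _ _).trans (by linarith)
        _ ≤ _ := by
            rw [mul_add]
            linarith [mul_le_mul_of_nonneg_right h1 hr.le]
    exact le_of_mul_le_mul_left h6 (hε.trans_le h1)

theorem exists_shrinking (hP : IsConvexDecomposition P) {η δ : ℝ} (hη : 0 < η) (hδ : 0 < δ)
    (R : ℝ) : ∃ h : ℝ × ℝ ≃ₜ ℝ × ℝ, (∀ p, dist (P (h p)) (P p) < δ) ∧
      ∀ p q, P p = P q → ‖h p - h q‖ < η ∨ R < ‖h p‖ ∧ R < ‖h q‖ := by
  obtain ⟨δR, hδR, hbdd⟩ := hP.bounded (closedBall 0 R) isBounded_closedBall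
  wlog hle : δ ≤ δR generalizing δ
  · obtain ⟨h, h1, h2⟩ := this hδR le_rfl
    exact ⟨h, fun p => (h1 p).trans (not_le.1 hle), h2⟩
  obtain ⟨R₀, hR₀⟩ := hbdd.exists_norm_le
  let K : Set (ℝ × ℝ) := P ⁻¹' (P '' closedBall 0 R₀)
  have hK : IsCompact K := hP.isCompact_saturation (isCompact_closedBall 0 R₀)
  have hKsat : ∀ p q, P p = P q → p ∈ K → q ∈ K := by
    rintro p q hpq ⟨b, hb, hbp⟩
    exact ⟨b, hb, hbp.trans hpq⟩
  have hfar : ∀ h : ℝ × ℝ ≃ₜ ℝ × ℝ, (∀ p, dist (P (h p)) (P p) < δ) → ∀ p ∉ K, R < ‖h p‖ := by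
    intro h hh p hp
    by_contra hcon
    refine hp ⟨p, ?_, rfl⟩
    rw [mem_closedBall_zero_iff]
    refine hR₀ p ⟨h p, by simpa using hcon, ?_⟩
    rw [dist_comm]
    exact (hh p).trans_le hle
  have hα : 0 < η / 8 * (η / 32) / 2 := by positivity
  obtain ⟨g, g1, g2, d, hd, g3, g4⟩ := hP.shrinks_fat hK hKsat hα (η / 8) (by positivity) (δ / 2)
    (half_pos hδ)
  set F := fat P K (η / 8 * (η / 32) / 2)
  let O : Set (ℝ × ℝ) := {p | ∃ k ∈ F, dist (P p) (P k) < d / 2}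
  have hPc := hP.continuous
  have hO : IsOpen O := by
    have : O = ⋃ k ∈ F, {p | dist (P p) (P k) < d / 2} := by
      ext p
      simp [O]
    rw [this]
    exact isOpen_biUnion fun k _ => isOpen_lt (by fun_prop) continuous_const
  have hOsat : ∀ p q, P p = P q → p ∈ K \ O → q ∈ K \ O := by
    rintro p q hpq ⟨hp, hpO⟩
    refine ⟨hKsat p q hpq hp, ?_⟩
    rintro ⟨k, hk, hqk⟩
    exact hpO ⟨k, hk, by rwa [hpq]⟩
  have hKO : IsCompact (K \ O) := hK.diff hO
  have hthin : ∀ p ∈ K \ O, ∀ u v w, P u = P p → P v = P p → P w = P p →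
      |signedArea u v w| ≤ η / 8 * (η / 32) / 2 := by
    rintro p ⟨hp, hpO⟩ u v w hu hv hw
    by_contra hcon
    exact hpO ⟨p, ⟨hp, u, v, w, hu, hv, hw, (not_le.1 hcon).le⟩, by simpa using hd⟩
  have hX := hP.shrinks_wide hKO hOsat (ε := η / 8) (r := η / 32) (e := η / 8) (by positivity)
    (by positivity) (by positivity) hthin
  have hY := (hP.swap.shrinks_wide (A := Prod.swap ⁻¹' (K \ O))
    ((Homeomorph.prodComm ℝ ℝ).isCompact_preimage.2 hKO) (fun p q hpq hp => hOsat _ _ hpq hp)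
    (ε := η / 8) (r := η / 32) (e := η / 8) (by positivity) (by positivity) (by positivity) (by
      intro p hp u v w hu hv hw
      have := hthin _ hp _ _ _ hu hw hv
      convert this using 2
      simp only [signedArea, Prod.fst_swap, Prod.snd_swap]
      ring)).swap
  obtain ⟨f, f1, f2, d', hd', f3, f4⟩ := (hX.union (by positivity) (by positivity) hY)
    (min (δ / 2) (d / 4)) (by positivity)
  have f1' : ∀ p, dist (P (f p)) (P p) < d / 4 := fun p => (f1 p).trans_le (min_le_right _ _)
  have hclose : ∀ p, dist (P ((f.trans g) p)) (P p) < δ := by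
    intro p
    have := (f1 p).trans_le (min_le_left _ _)
    have := dist_triangle (P (g (f p))) (P (f p)) (P p)
    simp only [Homeomorph.trans_apply]
    linarith [g1 (f p)]
  refine ⟨f.trans g, hclose, fun p q hpq => ?_⟩
  by_cases hpK : p ∈ K
  swap
  · exact Or.inr ⟨hfar _ hclose p hpK, hfar _ hclose q fun hq => hpK (hKsat _ _ hpq.symm hq)⟩
  left
  simp only [Homeomorph.trans_apply]
  by_cases hpO : p ∈ O
  · obtain ⟨k, hk, hpk⟩ := hpO
    have h1 := dist_triangle (P (f p)) (P p) (P k)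
    have h2 := dist_triangle (P (f q)) (P q) (P k)
    rw [← hpq] at h2
    have h3 := f1' q
    rw [← hpq] at h3
    have := g4 k hk (f p) (f q) (by linarith [f1' p]) (by linarith)
    linarith
  have hb : ‖g (f p) - g (f q)‖ ≤ ‖f p - f q‖ + η / 8 := by
    refine g3 _ _ ?_
    have h1 := dist_triangle_right (P (f p)) (P (f q)) (P p)
    have h2 := f1' q
    rw [← hpq] at h2
    linarith [f1' p]
  by_cases hpA : p ∈ wide P (K \ O) (η / 8) ∪
      Prod.swap ⁻¹' (wide (P ∘ Prod.swap) (Prod.swap ⁻¹' (K \ O)) (η / 8))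
  · have := f4 p hpA p q (by simpa using hd') (by rw [← hpq]; simpa using hd')
    dsimp only at this
    linarith
  · have h1 : ‖p - q‖ < η / 8 := by
      by_contra hcon
      rw [not_lt, Prod.norm_def] at hcon
      simp only [Prod.fst_sub, Prod.snd_sub, Real.norm_eq_abs] at hcon
      refine hpA ?_
      rcases le_total |p.2 - q.2| |p.1 - q.1| with h | h
      · rw [max_eq_left h] at hcon
        exact Or.inl ⟨⟨hpK, hpO⟩, p, q, rfl, hpq.symm, hcon, h⟩
      · rw [max_eq_right h] at hcon
        exact Or.inr ⟨⟨hpK, hpO⟩, p.swap, q.swap, by simp, by simp [hpq], hcon, h⟩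
    have h2 := f3 p q (by simpa [hpq] using hd')
    dsimp only at h2
    linarith

end IsConvexDecomposition

section ProperMap

variable {X Y : Type*} [TopologicalSpace X] [TopologicalSpace Y] {f : X → Y}

theorem IsProperMap.isOpen_kernImage (hf : IsProperMap f) {U : Set X} (hU : IsOpen U) :
    IsOpen (kernImage f U) :=
  isClosedMap_iff_kernImage.1 hf.isClosedMap hU

theorem IsProperMap.isCompact_fiber (hf : IsProperMap f) (y : Y) : IsCompact (f ⁻¹' {y}) :=
  hf.isCompact_preimage isCompact_singleton

theorem IsProperMap.t2Space [T2Space X] (hf : IsProperMap f) (hs : Function.Surjective f) :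
    T2Space Y := by
  refine ⟨fun y z hyz => ?_⟩
  have hd : Disjoint (f ⁻¹' {y}) (f ⁻¹' {z}) := (disjoint_singleton.2 hyz).preimage f
  obtain ⟨U, V, hU, hV, hyU, hzV, hUV⟩ := SeparatedNhds.of_isCompact_isCompact (hf.isCompact_fiber y) (hf.isCompact_fiber z) hd
  refine ⟨_, _, hf.isOpen_kernImage hU, hf.isOpen_kernImage hV, fun x hx => hyU hx,
    fun x hx => hzV hx, ?_⟩
  rw [Set.disjoint_left]
  intro w hw hw'
  obtain ⟨x, rfl⟩ := hs w
  exact Set.disjoint_left.1 hUV (hw rfl) (hw' rfl)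

theorem IsProperMap.weaklyLocallyCompactSpace [WeaklyLocallyCompactSpace X] (hf : IsProperMap f)
    (hs : Function.Surjective f) : WeaklyLocallyCompactSpace Y := by
  refine ⟨fun y => ?_⟩
  obtain ⟨K, hK, hyK⟩ := exists_compact_superset (hf.isCompact_fiber y)
  refine ⟨f '' K, hK.image hf.continuous, mem_of_superset
    ((hf.isOpen_kernImage isOpen_interior).mem_nhds fun x hx => hyK hx) fun w hw => ?_⟩
  obtain ⟨x, rfl⟩ := hs w
  exact ⟨x, interior_subset (hw rfl), rfl⟩

theorem IsProperMap.secondCountableTopology [SecondCountableTopology X] (hf : IsProperMap f)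
    (hs : Function.Surjective f) : SecondCountableTopology Y := by
  let b := TopologicalSpace.countableBasis X
  let c : Set (Set Y) := (fun F : Set (Set X) => kernImage f (⋃₀ F)) '' {F | F.Finite ∧ F ⊆ b}
  have hcount : c.Countable :=
    (countable_ofPred_finite_subset (TopologicalSpace.countable_countableBasis X)).image _
  have hb := TopologicalSpace.isBasis_countableBasis X
  refine TopologicalSpace.IsTopologicalBasis.secondCountableTopology (b := c) ?_ hcount
  refine TopologicalSpace.isTopologicalBasis_of_isOpen_of_nhds ?_ ?_
  · rintro _ ⟨F, ⟨-, hF⟩, rfl⟩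
    exact hf.isOpen_kernImage (isOpen_sUnion fun u hu => hb.isOpen (hF hu))
  · intro y W hy hW
    have hV : IsOpen (f ⁻¹' W) := hW.preimage hf.continuous
    obtain ⟨F, hF, hFfin, hcov⟩ := (hf.isCompact_fiber y).elim_finite_subcover_image
      (b := {u | u ∈ b ∧ u ⊆ f ⁻¹' W}) (c := id) (fun u hu => hb.isOpen hu.1) (by
        intro x hx
        obtain ⟨u, hu, hxu, huW⟩ := hb.exists_subset_of_mem_open
          (show x ∈ f ⁻¹' W by rw [mem_preimage, show f x = y from hx]; exact hy) hV
        exact mem_biUnion (show u ∈ {u | u ∈ b ∧ u ⊆ f ⁻¹' W} from ⟨hu, huW⟩) hxu)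
    refine ⟨_, ⟨F, ⟨hFfin, fun u hu => (hF hu).1⟩, rfl⟩, fun x hx => ?_, fun w hw => ?_⟩
    · obtain ⟨u, hu, hxu⟩ := mem_iUnion₂.1 (hcov hx)
      exact ⟨u, hu, hxu⟩
    · obtain ⟨x, rfl⟩ := hs w
      obtain ⟨u, hu, hxu⟩ := hw rfl
      exact (hF hu).2 hxu

end ProperMap

section Bing

variable {X Y : Type*} [MetricSpace X] [CompactSpace X] [MetricSpace Y]

theorem isOpen_setOf_fiber_small (ε : ℝ) :
    IsOpen {q : C(X, Y) | ∀ x y, q x = q y → dist x y < ε} := by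
  have hcl : IsClosed {z : C(X, Y) × (X × X) | z.1 z.2.1 = z.1 z.2.2 ∧ ε ≤ dist z.2.1 z.2.2} :=
    (isClosed_eq (f := fun z : C(X, Y) × (X × X) => z.1 z.2.1) (g := fun z => z.1 z.2.2)
      (by fun_prop) (by fun_prop)).inter (isClosed_le continuous_const
      (g := fun z : C(X, Y) × (X × X) => dist z.2.1 z.2.2) (by fun_prop))
  have := isClosedMap_fst_of_compactSpace _ hcl
  rw [← isOpen_compl_iff] at this
  convert this using 1
  ext q
  simp only [mem_ofPred_eq, mem_compl_iff, mem_image, Prod.exists, not_exists, not_and]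
  constructor
  · rintro h q' x y ⟨h1, h2⟩ rfl
    exact absurd (h x y h1) (not_lt.2 h2)
  · intro h x y hxy
    by_contra hd
    exact h q x y ⟨hxy, not_lt.1 hd⟩ rfl

/-- **Bing's shrinking criterion** with a base point. -/
theorem exists_homeomorph_of_shrinking [CompactSpace Y] (π : C(X, Y))
    (hπ : Function.Surjective π) (x₀ : X)
    (hshrink : ∀ ε > 0, ∀ δ > 0, ∃ h : X ≃ₜ X, h x₀ = x₀ ∧ (∀ x, dist (π (h x)) (π x) < δ) ∧
      ∀ x y, π x = π y → dist (h x) (h y) < ε) :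
    ∃ Φ : X ≃ₜ Y, Φ x₀ = π x₀ := by
  have : Nonempty X := ⟨x₀⟩
  let A : Set C(X, Y) := {q | ∃ h : X ≃ₜ X, h x₀ = x₀ ∧ q = π.comp (h : C(X, X))}
  have hA : (closure A).Nonempty := ⟨π, subset_closure ⟨Homeomorph.refl X, rfl, rfl⟩⟩
  have : CompleteSpace (closure A) := isClosed_closure.completeSpace_coe
  let O : ℕ → Set (closure A) := fun n => {q | ∀ x y, q.1 x = q.1 y → dist x y < 1 / ((n : ℝ) + 1)}
  have hO : ∀ n, IsOpen (O n) := fun n =>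
    (isOpen_setOf_fiber_small (1 / ((n : ℝ) + 1))).preimage continuous_subtype_val
  have hd : ∀ n, Dense (O n) := by
    intro n
    rw [Metric.dense_iff]
    rintro ⟨q, hq⟩ r hr
    obtain ⟨_, ⟨h₀, hx₀, rfl⟩, hqr⟩ := Metric.mem_closure_iff.1 hq (r / 2) (half_pos hr)
    have huc : UniformContinuous h₀.symm :=
      CompactSpace.uniformContinuous_of_continuous h₀.symm.continuous
    obtain ⟨η, hη, hη'⟩ := Metric.uniformContinuous_iff.1 huc (1 / ((n : ℝ) + 1))
      Nat.one_div_pos_of_nat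
    obtain ⟨h, hh₀, hh, hε⟩ := hshrink η hη (r / 2) (half_pos hr)
    have hmem : π.comp ((h₀.trans h.symm : X ≃ₜ X) : C(X, X)) ∈ A :=
      ⟨h₀.trans h.symm, by
        rw [Homeomorph.trans_apply, hx₀, Homeomorph.symm_apply_eq, hh₀], rfl⟩
    refine ⟨⟨_, subset_closure hmem⟩, ?_, ?_⟩
    · rw [mem_ball, dist_comm, Subtype.dist_eq]
      refine (dist_triangle _ _ _).trans_lt ((add_lt_add_of_lt_of_le hqr ?_).trans_eq
        (add_halves r))
      refine (ContinuousMap.dist_le (half_pos hr).le).2 fun x => ?_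
      simpa using (hh (h.symm (h₀ x))).le
    · intro x y hxy
      have := hη' (by simpa using hε (h.symm (h₀ x)) (h.symm (h₀ y)) hxy)
      simpa using this
  have hdense := dense_iInter_of_isOpen hO hd
  obtain ⟨⟨q, hqA⟩, hq⟩ := (hdense.inter_open_nonempty univ isOpen_univ
    (by obtain ⟨a, ha⟩ := hA; exact ⟨⟨a, ha⟩, trivial⟩))
  replace hq := mem_iInter.1 hq.2
  have hinj : Function.Injective q := by
    intro x y hxy
    by_contra hne
    obtain ⟨n, hn⟩ := exists_nat_one_div_lt (dist_pos.2 hne)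
    exact absurd (hq n x y hxy) (not_lt.2 hn.le)
  have hbase : q x₀ = π x₀ := by
    have hcl : IsClosed {q : C(X, Y) | q x₀ = π x₀} := isClosed_eq (by fun_prop) (by fun_prop)
    refine closure_minimal ?_ hcl hqA
    rintro _ ⟨h, hh, rfl⟩
    simp [hh]
  have hsurj : Function.Surjective q := by
    intro y
    have hcl : IsClosed {z : C(X, Y) × X | z.1 z.2 = y} := isClosed_eq (by fun_prop) (by fun_prop)
    have := isClosedMap_fst_of_compactSpace _ hcl
    obtain ⟨⟨q', x⟩, h1, rfl⟩ := closure_minimal (s := A) (by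
      rintro _ ⟨h, -, rfl⟩
      obtain ⟨x, hx⟩ := hπ y
      exact ⟨⟨_, h.symm x⟩, by simpa using hx, rfl⟩) this hqA
    exact ⟨x, h1⟩
  exact ⟨Continuous.homeoOfEquivCompactToT2 (f := Equiv.ofBijective q ⟨hinj, hsurj⟩)
    q.continuous, hbase⟩

end Bing

theorem nonempty_homeomorph_of_onePoint {X Y : Type*} [TopologicalSpace X] [TopologicalSpace Y]
    (Φ : OnePoint X ≃ₜ OnePoint Y) (h : Φ OnePoint.infty = OnePoint.infty) :
    Nonempty (X ≃ₜ Y) := by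
  have hX : range ((↑) : X → OnePoint X) = Φ ⁻¹' range ((↑) : Y → OnePoint Y) := by
    rw [← OnePoint.compl_infty, ← OnePoint.compl_infty]
    ext x
    rw [mem_preimage, mem_compl_singleton_iff, mem_compl_singleton_iff, ← h, Φ.injective.ne_iff]
  exact ⟨(OnePoint.isOpenEmbedding_coe (X := X)).toIsEmbedding.toHomeomorph.trans
    ((Φ.sets hX).trans (OnePoint.isOpenEmbedding_coe (X := Y)).toIsEmbedding.toHomeomorph.symm)⟩

/-- **Moore's theorem** for convex point-inverses: a proper image of the plane under a map with
convex fibres is homeomorphic to the plane. -/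
theorem IsProperMap.nonempty_homeomorph_of_convex_fiber {Q : Type*} [TopologicalSpace Q]
    {f : ℝ × ℝ → Q} (hf : IsProperMap f) (hs : Function.Surjective f)
    (hconv : ∀ p, Convex ℝ {q | f q = f p}) : Nonempty (ℝ × ℝ ≃ₜ Q) := by
  have : T2Space Q := hf.t2Space hs
  have : WeaklyLocallyCompactSpace Q := hf.weaklyLocallyCompactSpace hs
  have hfc : Tendsto f (cocompact _) (cocompact _) :=
    (isProperMap_iff_tendsto_cocompact.1 hf).2
  have hFc : Continuous (OnePoint.map f) := OnePoint.continuous_map hf.continuous (by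
    rwa [coclosedCompact_eq_cocompact, coclosedCompact_eq_cocompact])
  have hFs : Function.Surjective (OnePoint.map f) := by
    intro y
    induction y using OnePoint.rec with
    | infty => exact ⟨OnePoint.infty, rfl⟩
    | coe y =>
      obtain ⟨p, rfl⟩ := hs y
      exact ⟨p, rfl⟩
  let sph : OnePoint (ℝ × ℝ) ≃ₜ sphere (0 : EuclideanSpace ℝ (Fin 3)) 1 :=
    onePointEquivSphereOfFinrankEq (by simp)
  have : TopologicalSpace.MetrizableSpace (OnePoint (ℝ × ℝ)) := sph.isEmbedding.metrizableSpace
  have : SecondCountableTopology (OnePoint (ℝ × ℝ)) := sph.isEmbedding.secondCountableTopology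
  have : SecondCountableTopology (OnePoint Q) := hFc.isProperMap.secondCountableTopology hFs
  let _ : MetricSpace (OnePoint (ℝ × ℝ)) := TopologicalSpace.metrizableSpaceMetric _
  let _ : MetricSpace (OnePoint Q) := TopologicalSpace.metrizableSpaceMetric _
  let P : ℝ × ℝ → OnePoint Q := fun p => (f p : OnePoint Q)
  have hP : IsConvexDecomposition P := by
    refine ⟨OnePoint.continuous_coe.comp hf.continuous, fun p => ?_, fun C hC => ?_⟩
    · simpa only [P, OnePoint.coe_eq_coe] using hconv p
    · have hK : IsCompact (f '' closure C) := hC.isCompact_closure.image hf.continuous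
      obtain ⟨K', hK', hKK'⟩ := exists_compact_superset hK
      obtain ⟨δ, hδ, hsub⟩ := (hK.image OnePoint.continuous_coe).exists_thickening_subset_open
        (OnePoint.isOpen_image_coe.2 (isOpen_interior (s := K'))) (image_mono hKK')
      refine ⟨δ, hδ, (hf.isCompact_preimage hK').isBounded.subset ?_⟩
      rintro q ⟨p, hp, hqp⟩
      have : P q ∈ thickening δ ((↑) '' (f '' closure C)) := mem_thickening_iff.2
        ⟨P p, mem_image_of_mem _ (mem_image_of_mem _ (subset_closure hp)), hqp⟩
      obtain ⟨y, hy, hyq⟩ := hsub this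
      have : y = f q := OnePoint.coe_eq_coe.1 hyq
      rw [this] at hy
      exact interior_subset (s := K') hy
  have htend : Tendsto ((↑) : ℝ × ℝ → OnePoint (ℝ × ℝ)) (cocompact _) (𝓝 OnePoint.infty) := by
    rw [← coclosedCompact_eq_cocompact]
    exact OnePoint.tendsto_coe_infty
  have huc : UniformContinuous ((↑) : ℝ × ℝ → OnePoint (ℝ × ℝ)) :=
    OnePoint.continuous_coe.uniformContinuous_of_tendsto_cocompact htend
  obtain ⟨Φ, hΦ⟩ := exists_homeomorph_of_shrinking ⟨OnePoint.map f, hFc⟩ hFs OnePoint.infty (by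
    intro ε hε δ hδ
    obtain ⟨η, hη, hη'⟩ := Metric.uniformContinuous_iff.1 huc ε hε
    have hnear : ∀ᶠ p : ℝ × ℝ in cocompact _, dist (p : OnePoint (ℝ × ℝ)) OnePoint.infty < ε / 2 :=
      htend.eventually (ball_mem_nhds _ (half_pos hε))
    rw [← Metric.cobounded_eq_cocompact, ← comap_norm_atTop, eventually_comap, eventually_atTop] at hnear
    obtain ⟨R, hR⟩ := hnear
    obtain ⟨h, h1, h2⟩ := hP.exists_shrinking hη hδ R
    refine ⟨h.onePointCongr, rfl, fun x => ?_, fun x y hxy => ?_⟩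
    · induction x using OnePoint.rec with
      | infty => exact (dist_self _).trans_lt hδ
      | coe p => exact h1 p
    · induction x using OnePoint.rec with
      | infty =>
        induction y using OnePoint.rec with
        | infty => exact (dist_self _).trans_lt hε
        | coe q => exact (OnePoint.infty_ne_coe _ hxy).elim
      | coe p =>
        induction y using OnePoint.rec with
        | infty => exact (OnePoint.coe_ne_infty _ hxy).elim
        | coe q =>
          change dist ((h p : ℝ × ℝ) : OnePoint (ℝ × ℝ)) (h q : ℝ × ℝ) < ε
          rcases h2 p q hxy with hpq | ⟨hp, hq⟩
          · exact hη' (by rwa [dist_eq_norm])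
          · exact (dist_triangle_right _ _ _).trans_lt ((add_lt_add (hR _ hp.le _ rfl)
              (hR _ hq.le _ rfl)).trans_eq (add_halves ε)))
  exact nonempty_homeomorph_of_onePoint Φ hΦ

end

/-- Moore's theorem: If `G` is an upper semicontinuous decomposition of `ℝ²`
into compact convex sets, then the quotient space `ℝ²/G` is homeomorphic to `ℝ²`. -/
theorem convex_decomposition_plane_quotient_homeomorphic
    (S : Setoid (EuclideanSpace ℝ (Fin 2)))
    (hcompact : ∀ x, IsCompact {y | S x y})
    (hconvex : ∀ x, Convex ℝ {y | S x y})
    (hproper : IsProperMap (Quotient.mk S)) :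
    Nonempty (Quotient S ≃ₜ EuclideanSpace ℝ (Fin 2)) := by
  obtain ⟨e⟩ : Nonempty ((ℝ × ℝ) ≃L[ℝ] EuclideanSpace ℝ (Fin 2)) :=
    FiniteDimensional.nonempty_continuousLinearEquiv_of_finrank_eq (by simp)
  obtain ⟨Ψ⟩ := IsProperMap.nonempty_homeomorph_of_convex_fiber
    (hproper.comp e.toHomeomorph.isProperMap)
    (Quotient.mk_surjective.comp e.surjective) (fun p => by
      have hfib : {q | Quotient.mk S (e q) = Quotient.mk S (e p)} = e ⁻¹' {y | S (e p) y} := by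
        ext q
        exact Quotient.eq.trans ⟨S.symm, S.symm⟩
      exact hfib ▸ (hconvex (e p)).linear_preimage e.toLinearEquiv.toLinearMap)
  exact ⟨Ψ.symm.trans e.toHomeomorph⟩
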